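/- arXiv:2506.09750 — 5 statements merged into one kernel-verified Lean document; each statement's English description precedes it below -/
import Mathlib

section
/- Let G be a 2-connected finite simple graph. Then G contains a cycle passing through every vertex of G whose degree is at least the bipartite-hole-number of G. -/
/-- An `(s,t)`-bipartite-hole in a graph `G` consists of two disjoint sets of vertices
`S` and `T` with `|S| = s` and `|T| = t` such that `G` has no edge between `S` and `T`. -/
def SimpleGraph.HasBipartiteHole {V : Type*} (G : SimpleGraph V) (s t : ℕ) : Prop :=
  ∃ S T : Finset V, Disjoint S T ∧ S.card = s ∧ T.card = t ∧
    ∀ a ∈ S, ∀ b ∈ T, ¬ G.Adj a b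

/-- The bipartite-hole-number `α̃(G)`: the minimum integer `k` such that there exist positive
integers `s` and `t` with `s + t = k + 1` for which `G` contains no `(s,t)`-bipartite-hole. -/
noncomputable def SimpleGraph.bipartiteHoleNumber {V : Type*} (G : SimpleGraph V) : ℕ :=
  sInf {k : ℕ | ∃ s t : ℕ, 0 < s ∧ 0 < t ∧ s + t = k + 1 ∧ ¬ G.HasBipartiteHole s t}

/-- A graph is 2-connected if it has at least 3 vertices and remains connected after deleting
any single vertex. -/
def SimpleGraph.TwoConnected {V : Type*} [Fintype V] (G : SimpleGraph V) : Prop :=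
  3 ≤ Fintype.card V ∧ ∀ v : V, (G.induce {u | u ≠ v}).Connected

namespace SimpleGraph

variable {V : Type*} {G : SimpleGraph V}

/-- Some cycle of `G` passes through every vertex of `s`. -/
def HasCycleThrough (G : SimpleGraph V) (s : Set V) : Prop :=
  ∃ (a : V) (c : G.Walk a a), c.IsCycle ∧ ∀ x ∈ s, x ∈ c.support

theorem HasCycleThrough.mono {s t : Set V} (h : G.HasCycleThrough t) (hst : s ⊆ t) :
    G.HasCycleThrough s := by
  obtain ⟨a, c, hc, h⟩ := h
  exact ⟨a, c, hc, fun x hx => h x (hst hx)⟩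

/-- A path on at least three vertices whose ends are adjacent closes up to a cycle. -/
theorem HasCycleThrough.of_isPath {u v : V} {p : G.Walk u v} (hp : p.IsPath)
    (hlen : 2 ≤ p.length) (h : G.Adj v u) : G.HasCycleThrough {x | x ∈ p.support} := by
  refine ⟨v, .cons h p, ?_, fun x hx => by simpa using Or.inr hx⟩
  rw [Walk.isCycle_iff_isPath_tail_and_le_length]
  simpa using ⟨hp, by omega⟩

/-- A duplicate-free cyclic list of at least three vertices, consecutive ones adjacent, is a
cycle. -/
theorem HasCycleThrough.of_list {l : List V} (hl : l.Nodup) (hlen : 3 ≤ l.length)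
    (hc : l.IsChain G.Adj) (h : ∀ x ∈ l.getLast?, ∀ y ∈ l.head?, G.Adj x y) :
    G.HasCycleThrough {x | x ∈ l} := by
  have hne : l ≠ [] := by rintro rfl; simp at hlen
  have := HasCycleThrough.of_isPath (p := Walk.ofSupport l hne hc)
    (by rw [Walk.isPath_def, Walk.support_ofSupport]; exact hl)
    (by rw [Walk.length_ofSupport]; omega)
    (h _ (List.getLast?_eq_some_getLast hne) _ (List.head?_eq_some_head hne))
  simpa using this

/-- A clique on at least three vertices has a cycle through all of them. -/
theorem HasCycleThrough.of_isClique {s : Finset V} (hs : G.IsClique s) (h : 3 ≤ s.card) :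
    G.HasCycleThrough s := by
  have hadj : ∀ x ∈ s.toList, ∀ y ∈ s.toList, x ≠ y → G.Adj x y := fun x hx y hy hxy =>
    hs (by simpa using hx) (by simpa using hy) hxy
  have hnd := s.nodup_toList
  have hlen : 3 ≤ s.toList.length := by simpa using h
  refine (HasCycleThrough.of_list hnd hlen (List.Pairwise.isChain ?_) ?_).mono
    (fun x hx => by simpa using hx)
  · exact hnd.imp_of_mem fun hx hy hxy => hadj _ hx _ hy hxy
  · generalize s.toList = l at *
    intro x hx y hy
    refine hadj x (List.mem_of_getLast? hx) y (List.mem_of_head? hy) ?_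
    rintro rfl
    rw [Option.mem_def, List.head?_eq_getElem?, List.getElem?_eq_some_iff] at hy
    rw [Option.mem_def, List.getLast?_eq_getElem?, List.getElem?_eq_some_iff] at hx
    obtain ⟨h0, e0⟩ := hy
    obtain ⟨h1, e1⟩ := hx
    have := (hnd.getElem_inj_iff (hi := h0) (hj := h1)).1 (e0.trans e1.symm)
    omega

/-- If adding the edge `uv` creates a cycle through `s`, then `G` has such a cycle, or a path
through `s` with ends `u` and `v`. -/
theorem HasCycleThrough.of_sup_edge {u v : V} {s : Set V}
    (h : (G ⊔ edge u v).HasCycleThrough s) :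
    G.HasCycleThrough s ∨ ∃ p : G.Walk u v, p.IsPath ∧ ∀ x ∈ s, x ∈ p.support := by
  obtain ⟨a, c, hc, hs⟩ := h
  by_cases he : s(u, v) ∈ c.edges
  · right
    have key : ∀ x y (hxy : (G ⊔ edge u v).Adj x y), s(x, y) = s(u, v) →
        hxy.toWalk.IsSubwalk c →
        ∃ p : G.Walk y x, p.IsPath ∧ ∀ z ∈ s, z ∈ p.support := by
      rintro x y hxy exy ⟨p, q, rfl⟩
      have hed := hc.edges_nodup
      have hsn := hc.support_nodup
      simp only [Walk.edges_append] at hed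
      have hmem : ∀ e ∈ (q.append p).edges, e ∈ G.edgeSet := by
        intro e he
        have h1 := (q.append p).edges_subset_edgeSet he
        have h2 : e ≠ s(u, v) := by
          rintro rfl
          simp [← exy] at he hed
          grind
        induction e with | _ a b =>
        simp only [mem_edgeSet, sup_adj, edge_adj] at h1 ⊢
        grind
      refine ⟨(q.append p).transfer G hmem, Walk.IsPath.transfer hmem ?_, ?_⟩
      · rw [Walk.isPath_def, Walk.support_append]
        simp only [Walk.tail_support_append, List.append_assoc] at hsn
        simp only [Adj.toWalk, Walk.support_cons, Walk.support_nil, List.tail_cons] at hsn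
        rw [← q.cons_tail_support]
        exact (List.perm_append_comm.nodup_iff).1 hsn
      · intro z hz
        have := hs z hz
        simp at this ⊢
        grind [Walk.start_mem_support, Walk.end_mem_support]
    have huv : (G ⊔ edge u v).Adj u v := c.edges_subset_edgeSet he
    rcases (Walk.isSubwalk_toWalk_iff_mem_edges huv).2 he with h | h
    · obtain ⟨p, hp, h⟩ := key u v huv rfl h
      exact ⟨p.reverse, hp.reverse, by simpa using h⟩
    · exact key v u huv.symm Sym2.eq_swap h
  · left
    have hmem : ∀ e ∈ c.edges, e ∈ G.edgeSet := by
      intro e he'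
      have h1 := c.edges_subset_edgeSet he'
      have h2 : e ≠ s(u, v) := by
        rintro rfl; exact he he'
      induction e with | _ a b =>
      simp only [mem_edgeSet, sup_adj, edge_adj] at h1 ⊢
      grind
    exact ⟨a, c.transfer G hmem, hc.transfer hmem, by simpa using hs⟩

/-- The list `l` traces a walk of `G` from `u` to `v`. -/
structure IsWalkList (G : SimpleGraph V) (l : List V) (u v : V) : Prop where
  isChain : l.IsChain G.Adj
  head?_eq : l.head? = some u
  getLast?_eq : l.getLast? = some v

namespace IsWalkList

variable {l l' : List V} {u v w x : V}

theorem singleton (u : V) : G.IsWalkList [u] u u := ⟨by simp, by simp, by simp⟩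

theorem append (h : G.IsWalkList l u v) (hvw : G.Adj v w) (h' : G.IsWalkList l' w x) :
    G.IsWalkList (l ++ l') u x := by
  refine ⟨List.isChain_append.2 ⟨h.1, h'.1, ?_⟩, ?_, ?_⟩
  · simpa [h.3, h'.2] using hvw
  · simp [h.2]
  · simp [h'.3]

theorem reverse (h : G.IsWalkList l u v) : G.IsWalkList l.reverse v u :=
  ⟨List.isChain_reverse.2 (h.1.imp fun _ _ h => h.symm), by simp [h.3], by simp [h.2]⟩

theorem take (h : G.IsWalkList l u v) {i : ℕ} (hi : i < l.length) :
    G.IsWalkList (l.take (i + 1)) u l[i] :=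
  ⟨h.1.take _, by simp [List.head?_take, h.2], by simp [List.getLast?_take, hi]⟩

theorem drop (h : G.IsWalkList l u v) {i : ℕ} (hi : i < l.length) :
    G.IsWalkList (l.drop i) l[i] v :=
  ⟨h.1.drop _, by simp [hi], by rw [List.getLast?_drop, if_neg (by omega), h.3]⟩

theorem slice (h : G.IsWalkList l u v) {i j : ℕ} (hij : i ≤ j) (hj : j < l.length) :
    G.IsWalkList ((l.take (j + 1)).drop i) l[i] l[j] := by
  have := (h.take hj).drop (i := i) (by simp; omega)
  rwa [List.getElem_take] at this

theorem hasCycleThrough (h : G.IsWalkList l u v) (hl : l.Nodup) (hlen : 3 ≤ l.length)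
    (hvu : G.Adj v u) : G.HasCycleThrough {x | x ∈ l} :=
  .of_list hl hlen h.1 (by simpa [h.2, h.3] using hvu)

theorem hasCycleThrough_of_common_neighbor (h : G.IsWalkList l u v) (hl : l.Nodup)
    (hlen : 2 ≤ l.length) (hx : x ∉ l) (hux : G.Adj u x) (hvx : G.Adj v x) :
    G.HasCycleThrough {x | x ∈ l} :=
  (((singleton x).append hux.symm h).hasCycleThrough (by simp [hx, hl])
    (by simp; omega) hvx).mono fun _ h => List.mem_cons_of_mem _ h

theorem hasCycleThrough_of_adj_outside (h : G.IsWalkList l u v) (hl : l.Nodup)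
    (hlen : 2 ≤ l.length) {y : V} (hx : x ∉ l) (hy : y ∉ l) (hux : G.Adj u x)
    (hvy : G.Adj v y) (hxy : G.Adj x y) : G.HasCycleThrough {x | x ∈ l} :=
  (((singleton x).append hux.symm (h.append hvy (singleton y))).hasCycleThrough
    (by have := hxy.ne; grind) (by simp; omega) hxy.symm).mono fun _ h => by simp_all

theorem perm_take_append_reverse_drop (l : List V) (i : ℕ) :
    (l.take i ++ (l.drop i).reverse).Perm l :=
  (List.Perm.append_left _ (List.reverse_perm _)).trans (by rw [List.take_append_drop])

theorem perm_slices (l : List V) {i j : ℕ} (hij : i ≤ j) :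
    (l.take i ++ (l.take j).drop i ++ l.drop j).Perm l := by
  have : l.take i = (l.take j).take i := by rw [List.take_take, min_eq_left hij]
  rw [this, List.take_append_drop, List.take_append_drop]

/-- An outside neighbour `x` of the first vertex `u` is adjacent to the successor of a neighbour
of the last vertex `v`. -/
theorem hasCycleThrough_of_adj_succ (h : G.IsWalkList l u v) (hl : l.Nodup) {j : ℕ}
    (hj : j + 1 < l.length) (hx : x ∉ l) (hux : G.Adj u x) (hvj : G.Adj v l[j])
    (hxj : G.Adj x l[j + 1]) : G.HasCycleThrough {x | x ∈ l} := by
  have hperm := (perm_take_append_reverse_drop l (j + 1)).cons x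
  refine (((singleton x).append hux.symm ((h.take (by omega)).append hvj.symm
    (h.drop hj).reverse)).hasCycleThrough (hperm.nodup_iff.2 (by simp [hx, hl]))
    (by rw [List.singleton_append, hperm.length_eq]; simp; omega) hxj.symm).mono
    fun y hy => hperm.mem_iff.2 (List.mem_cons_of_mem _ hy)

theorem hasCycleThrough_of_adj_pred (h : G.IsWalkList l u v) (hl : l.Nodup) {i : ℕ}
    (hi : i + 1 < l.length) (hx : x ∉ l) (hvx : G.Adj v x) (hui : G.Adj u l[i + 1])
    (hxi : G.Adj x l[i]) : G.HasCycleThrough {x | x ∈ l} := by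
  have hlen : l.length - 2 - i + 1 < l.reverse.length := by simp; omega
  refine (h.reverse.hasCycleThrough_of_adj_succ (List.nodup_reverse.2 hl) hlen (by simpa)
    hvx ?_ ?_).mono fun y hy => by simpa using hy
  · rw [List.getElem_reverse]
    convert hui using 2
    omega
  · rw [List.getElem_reverse]
    convert hxi using 2
    omega

theorem hasCycleThrough_of_crossing (h : G.IsWalkList l u v) (hl : l.Nodup)
    (hlen : 3 ≤ l.length) {i : ℕ} (hi : i + 1 < l.length) (hui : G.Adj u l[i + 1])
    (hvi : G.Adj v l[i]) : G.HasCycleThrough {x | x ∈ l} := by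
  have hperm := perm_take_append_reverse_drop l (i + 1)
  exact (((h.take (by omega)).append hvi.symm (h.drop hi).reverse).hasCycleThrough
    (hperm.nodup_iff.2 hl) (by rwa [hperm.length_eq]) hui.symm).mono
    fun y hy => hperm.mem_iff.2 hy

/-- The predecessor of a neighbour of `u` is adjacent to the successor of a later neighbour
of `v`. -/
theorem hasCycleThrough_of_adj_pred_succ (h : G.IsWalkList l u v) (hl : l.Nodup) {i j : ℕ}
    (hij : i < j) (hj : j + 1 < l.length) (hui : G.Adj u l[i + 1]) (hvj : G.Adj v l[j])
    (hadj : G.Adj l[i] l[j + 1]) : G.HasCycleThrough {x | x ∈ l} := by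
  have hperm : ((l.take (i + 1)).reverse ++ ((l.take (j + 1)).drop (i + 1) ++
      (l.drop (j + 1)).reverse)).Perm l := by
    refine .trans ?_ (perm_slices l (show i + 1 ≤ j + 1 by omega))
    rw [List.append_assoc]
    exact (List.reverse_perm _).append ((List.Perm.refl _).append (List.reverse_perm _))
  exact (((h.take (by omega)).reverse.append hui ((h.slice (by omega) (by omega)).append
    hvj.symm (h.drop hj).reverse)).hasCycleThrough (hperm.nodup_iff.2 hl)
    (by rw [hperm.length_eq]; omega) hadj.symm).mono fun y hy => hperm.mem_iff.2 hy

/-- The successor of a neighbour of `v` is adjacent to the successor of a later neighbour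
of `u`. -/
theorem hasCycleThrough_of_adj_succ_succ (h : G.IsWalkList l u v) (hl : l.Nodup) {i j : ℕ}
    (hji : j ≤ i) (hi : i + 2 < l.length) (hui : G.Adj u l[i + 1]) (hvj : G.Adj v l[j])
    (hadj : G.Adj l[j + 1] l[i + 2]) : G.HasCycleThrough {x | x ∈ l} := by
  have hperm : (l.take (j + 1) ++ ((l.drop (i + 2)).reverse ++
      (l.take (i + 2)).drop (j + 1))).Perm l := by
    refine .trans ?_ (perm_slices l (show j + 1 ≤ i + 2 by omega))
    rw [List.append_assoc]
    exact (List.Perm.refl _).append (((List.reverse_perm _).append (.refl _)).trans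
      List.perm_append_comm)
  exact (((h.take (by omega)).append hvj.symm ((h.drop hi).reverse.append hadj.symm
    (h.slice (by omega) (by omega)))).hasCycleThrough (hperm.nodup_iff.2 hl)
    (by rw [hperm.length_eq]; omega) hui.symm).mono fun y hy => hperm.mem_iff.2 hy

end IsWalkList

theorem exists_adj_of_not_hasBipartiteHole {s t : ℕ} (h : ¬ G.HasBipartiteHole s t)
    {S T : Finset V} (hS : s ≤ S.card) (hT : t ≤ T.card) (hST : Disjoint S T) :
    ∃ a ∈ S, ∃ b ∈ T, G.Adj a b := by
  by_contra! hno
  obtain ⟨S', hS', rfl⟩ := Finset.exists_subset_card_eq hS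
  obtain ⟨T', hT', rfl⟩ := Finset.exists_subset_card_eq hT
  exact h ⟨S', T', hST.mono hS' hT', rfl, rfl, fun a ha b hb => hno a (hS' ha) b (hT' hb)⟩

/-- If `G` has no `(s, t)`-bipartite-hole, then a path whose ends are non-adjacent and have
degree at least `s + t - 1` can be rearranged to a cycle through all its vertices. -/
theorem IsWalkList.hasCycleThrough_of_not_hasBipartiteHole [Finite V] {s t : ℕ} (hs : 0 < s)
    (ht : 0 < t) (hG : ¬ G.HasBipartiteHole s t) {l : List V} {u v : V} (h : G.IsWalkList l u v)
    (hl : l.Nodup) (huv : u ≠ v) (hadj : ¬ G.Adj u v)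
    (hu : s + t ≤ (G.neighborSet u).ncard + 1) (hv : s + t ≤ (G.neighborSet v).ncard + 1) :
    G.HasCycleThrough {x | x ∈ l} := by
  classical
  cases nonempty_fintype V
  by_contra hno
  obtain ⟨n, f, hn, hf0, hfn, hmem, hinj, hfl⟩ : ∃ (n : ℕ) (f : ℕ → V), l.length = n + 1 ∧
      f 0 = u ∧ f n = v ∧ (∀ x, x ∈ l ↔ ∃ i ≤ n, f i = x) ∧
      (∀ i ≤ n, ∀ j ≤ n, f i = f j → i = j) ∧ (∀ i (hi : i < l.length), l[i] = f i) := by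
    have hpos : 0 < l.length := List.length_pos_of_mem (List.mem_of_mem_head? h.2)
    have hfl : ∀ i (hi : i < l.length), l[i] = l.getD i u := fun i hi => by simp [hi]
    refine ⟨l.length - 1, fun i => l.getD i u, by omega, ?_, ?_, fun x => ?_, ?_, hfl⟩
    · simp [← List.head?_eq_getElem?, h.2]
    · simp [← List.getLast?_eq_getElem?, h.3]
    · rw [List.mem_iff_getElem]
      constructor
      · rintro ⟨i, hi, rfl⟩
        exact ⟨i, by omega, (hfl i hi).symm⟩
      · rintro ⟨i, hi, rfl⟩
        exact ⟨i, by omega, hfl i (by omega)⟩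
    · intro i hi j hj hij
      dsimp only at hij
      rw [← hfl i (by omega), ← hfl j (by omega)] at hij
      exact (hl.getElem_inj_iff).1 hij
  have hn2 : 2 ≤ n := by
    rcases n with _ | _ | n
    · exact absurd (hf0.symm.trans hfn) huv
    · have := List.isChain_iff_getElem.1 h.1 0 (by omega)
      rw [hfl, hfl, hf0, hfn] at this
      exact absurd this hadj
    · omega
  set U : Finset V := {x | G.Adj u x ∧ x ∉ l} with hU
  set W : Finset V := {x | G.Adj v x ∧ x ∉ l} with hW
  set I : Finset ℕ := {i ∈ Finset.range n | G.Adj u (f (i + 1))} with hI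
  set J : Finset ℕ := {j ∈ Finset.range n | G.Adj v (f j)} with hJ
  have hIU : s + t ≤ U.card + I.card + 1 := by
    have hsub : G.neighborFinset u ⊆ U ∪ I.image (fun i => f (i + 1)) := by
      intro x hx
      rw [mem_neighborFinset] at hx
      by_cases hxl : x ∈ l
      · obtain ⟨i, hi, rfl⟩ := (hmem x).1 hxl
        rcases i with _ | i
        · rw [hf0] at hx; exact absurd hx G.irrefl
        · simp only [Finset.mem_union, Finset.mem_image]
          exact .inr ⟨i, by simp [hI, hx]; omega, rfl⟩
      · simp [hU, hx, hxl]
    have h1 := (Finset.card_le_card hsub).trans (Finset.card_union_le _ _)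
    have h2 := Finset.card_image_le (s := I) (f := fun i => f (i + 1))
    rw [Set.ncard_eq_toFinset_card'] at hu
    have : (G.neighborFinset u).card = (G.neighborSet u).toFinset.card := rfl
    omega
  have hJW : s + t ≤ W.card + J.card + 1 := by
    have hsub : G.neighborFinset v ⊆ W ∪ J.image f := by
      intro x hx
      rw [mem_neighborFinset] at hx
      by_cases hxl : x ∈ l
      · obtain ⟨i, hi, rfl⟩ := (hmem x).1 hxl
        rcases hi.eq_or_lt with rfl | hi
        · rw [hfn] at hx; exact absurd hx G.irrefl
        · simp only [Finset.mem_union, Finset.mem_image]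
          exact .inr ⟨i, by simp [hJ, hx, hi], rfl⟩
      · simp [hW, hx, hxl]
    have h1 := (Finset.card_le_card hsub).trans (Finset.card_union_le _ _)
    have h2 := Finset.card_image_le (s := J) (f := f)
    rw [Set.ncard_eq_toFinset_card'] at hv
    have : (G.neighborFinset v).card = (G.neighborSet v).toFinset.card := rfl
    omega
  have hfmem : ∀ i ≤ n, f i ∈ l := fun i hi => (hmem _).2 ⟨i, hi, rfl⟩
  have hI2 : ∀ i ∈ I, i + 2 ≤ n ∧ G.Adj u (f (i + 1)) := by
    intro i hi
    simp only [hI, Finset.mem_filter, Finset.mem_range] at hi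
    refine ⟨?_, hi.2⟩
    by_contra hlt
    have : i + 1 = n := by omega
    rw [this, hfn] at hi
    exact hadj hi.2
  have hJ2 : ∀ j ∈ J, j + 1 ≤ n ∧ G.Adj v (f j) := by
    intro j hj
    simp only [hJ, Finset.mem_filter, Finset.mem_range] at hj
    exact ⟨by omega, hj.2⟩
  have hex : ∃ k, s ≤ U.card + (I.filter (· < k + 1)).card := by
    refine ⟨n, ?_⟩
    rw [Finset.filter_true_of_mem fun i hi => by have := (hI2 i hi).1; omega]
    omega
  obtain ⟨k, hk, hkmin⟩ : ∃ k, s ≤ U.card + (I.filter (· < k + 1)).card ∧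
      (0 < k → U.card + (I.filter (· < k)).card < s) := by
    refine ⟨Nat.find hex, Nat.find_spec hex, fun hpos => ?_⟩
    have := Nat.find_min hex (Nat.sub_lt hpos one_pos)
    rw [show Nat.find hex - 1 + 1 = Nat.find hex by omega] at this
    omega
  have hI_split := Finset.card_filter_add_card_filter_not (s := I) (· < k)
  have hJ_split := Finset.card_filter_add_card_filter_not (s := J) (· < k)
  have hU2 : ∀ x ∈ U, G.Adj u x ∧ x ∉ l := fun x hx => by simpa [hU] using hx
  have hW2 : ∀ x ∈ W, G.Adj v x ∧ x ∉ l := fun x hx => by simpa [hW] using hx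
  have hcross : ∀ i ∈ I, i ∉ J := by
    intro i hi hj
    obtain ⟨h1, h2⟩ := hI2 i hi
    obtain ⟨h3, h4⟩ := hJ2 i hj
    exact hno (h.hasCycleThrough_of_crossing hl (i := i) (by omega) (by omega)
      (by rwa [hfl]) (by rwa [hfl]))
  by_cases hT : t ≤ W.card + (J.filter (¬ · < k)).card
  · have hS1 : (U ∪ (I.filter (· < k + 1)).image f).card
        = U.card + (I.filter (· < k + 1)).card := by
      rw [Finset.card_union_of_disjoint, Finset.card_image_of_injOn]
      · intro i hi j hj hij
        grind
      · rw [Finset.disjoint_left]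
        intro x hx
        grind
    have hT1 : (W ∪ (J.filter (¬ · < k)).image (fun j => f (j + 1))).card
        = W.card + (J.filter (¬ · < k)).card := by
      rw [Finset.card_union_of_disjoint, Finset.card_image_of_injOn]
      · intro i hi j hj hij
        grind
      · rw [Finset.disjoint_left]
        intro x hx
        grind
    obtain ⟨a, ha, b, hb, hab⟩ := exists_adj_of_not_hasBipartiteHole hG
      (hS1 ▸ hk) (hT1 ▸ hT) (by
        rw [Finset.disjoint_left]
        intro x hx hx'
        simp only [Finset.mem_union, Finset.mem_image, Finset.mem_filter] at hx hx'
        rcases hx with hx | ⟨i, ⟨hi, hik⟩, rfl⟩ <;> rcases hx' with hx' | ⟨j, ⟨hj, hjk⟩, hij⟩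
        · exact hno (h.hasCycleThrough_of_common_neighbor hl (by omega) (hU2 x hx).2
            (hU2 x hx).1 (hW2 x hx').1)
        · grind
        · grind
        · grind)
    simp only [Finset.mem_union, Finset.mem_image, Finset.mem_filter] at ha hb
    rcases ha with ha | ⟨i, ⟨hi, hik⟩, rfl⟩ <;> rcases hb with hb | ⟨j, ⟨hj, hjk⟩, rfl⟩
    · exact hno (h.hasCycleThrough_of_adj_outside hl (by omega) (hU2 a ha).2
        (hW2 b hb).2 (hU2 a ha).1 (hW2 b hb).1 hab)
    · obtain ⟨h3, h4⟩ := hJ2 j hj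
      exact hno (h.hasCycleThrough_of_adj_succ hl (j := j) (by omega) (hU2 a ha).2
        (hU2 a ha).1 (by rwa [hfl]) (by rwa [hfl]))
    · obtain ⟨h1, h2⟩ := hI2 i hi
      exact hno (h.hasCycleThrough_of_adj_pred hl (i := i) (by omega) (hW2 b hb).2
        (hW2 b hb).1 (by rwa [hfl]) (by rw [hfl]; exact hab.symm))
    · obtain ⟨h1, h2⟩ := hI2 i hi
      obtain ⟨h3, h4⟩ := hJ2 j hj
      have hij : i < j := by
        have : i ≠ j := by rintro rfl; exact hcross i hi hj
        omega
      exact hno (h.hasCycleThrough_of_adj_pred_succ hl hij (by omega) (by rwa [hfl])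
        (by rwa [hfl]) (by rwa [hfl, hfl]))
  · have hS : s ≤ (J.filter (· < k)).card := by omega
    have hk0 : 0 < k := by
      by_contra hk0
      obtain rfl : k = 0 := by omega
      simp at hS
      omega
    have hT : t ≤ (I.filter (¬ · < k)).card := by have := hkmin hk0; omega
    obtain ⟨a, ha, b, hb, hab⟩ := exists_adj_of_not_hasBipartiteHole hG
      (S := (J.filter (· < k)).image (fun j => f (j + 1)))
      (T := (I.filter (¬ · < k)).image (fun i => f (i + 2)))
      (by
        rw [Finset.card_image_of_injOn]
        · exact hS
        · intro i hi j hj hij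
          grind)
      (by
        rw [Finset.card_image_of_injOn]
        · exact hT
        · intro i hi j hj hij
          grind)
      (by
        rw [Finset.disjoint_left]
        intro x hx hx'
        grind)
    simp only [Finset.mem_image, Finset.mem_filter] at ha hb
    obtain ⟨j, ⟨hj, hjk⟩, rfl⟩ := ha
    obtain ⟨i, ⟨hi, hik⟩, rfl⟩ := hb
    obtain ⟨h1, h2⟩ := hI2 i hi
    obtain ⟨h3, h4⟩ := hJ2 j hj
    exact hno (h.hasCycleThrough_of_adj_succ_succ hl (i := i) (j := j) (by omega) (by omega)
      (by rwa [hfl]) (by rwa [hfl]) (by rwa [hfl, hfl]))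

/-- Under the degree condition on `L`, a cycle through `L` exists as soon as `L` has at least
three vertices. -/
theorem hasCycleThrough_of_three_le_card [Finite V] {s t : ℕ} (hs : 0 < s) (ht : 0 < t)
    {L : Finset V} (hL : 3 ≤ L.card) (G : SimpleGraph V) (hG : ¬ G.HasBipartiteHole s t)
    (hdeg : ∀ v ∈ L, s + t ≤ (G.neighborSet v).ncard + 1) : G.HasCycleThrough L := by
  induction G using WellFoundedGT.induction with
  | ind G ih =>
    by_cases hclique : G.IsClique L
    · exact .of_isClique hclique hL
    · obtain ⟨u, hu, v, hv, huv, hadj⟩ : ∃ u ∈ L, ∃ v ∈ L, u ≠ v ∧ ¬ G.Adj u v := by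
        simpa [IsClique, Set.Pairwise] using hclique
      have hle : G ≤ G ⊔ edge u v := le_sup_left
      have hlt : G < G ⊔ edge u v := lt_sup_edge _ _ _ huv hadj
      rcases (ih _ hlt (fun ⟨S, T, h₁, h₂, h₃, h₄⟩ =>
          hG ⟨S, T, h₁, h₂, h₃, fun a ha b hb hab => h₄ a ha b hb (hle hab)⟩)
          (fun w hw => (hdeg w hw).trans (Nat.add_le_add_right
            (Set.ncard_le_ncard fun x hx => hle hx) 1))).of_sup_edge with h | ⟨p, hp, hpL⟩
      · exact h
      · refine (IsWalkList.hasCycleThrough_of_not_hasBipartiteHole hs ht hG (l := p.support)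
          ⟨p.isChain_adj_support, ?_, ?_⟩ ((Walk.isPath_def _).1 hp) huv hadj
          (hdeg u hu) (hdeg v hv)).mono hpL
        · rw [List.head?_eq_some_head p.support_ne_nil, p.head_support]
        · rw [List.getLast?_eq_some_getLast p.support_ne_nil, p.getLast_support]

theorem exists_isPath_notMem_support {w u v : V} (hw : (G.induce {x | x ≠ w}).Connected)
    (hu : u ≠ w) (hv : v ≠ w) : ∃ p : G.Walk u v, p.IsPath ∧ w ∉ p.support := by
  obtain ⟨p, hp⟩ := (hw ⟨u, hu⟩ ⟨v, hv⟩).exists_isPath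
  have hwp : w ∉ (p.map (Embedding.induce {x | x ≠ w}).toHom).support := by
    rw [Walk.support_map, List.mem_map]
    rintro ⟨x, -, hx⟩
    exact x.2 hx
  exact ⟨_, hp.map (Embedding.induce (G := G) {x | x ≠ w}).injective, hwp⟩

theorem TwoConnected.exists_ne_ne [Fintype V] (hG : G.TwoConnected) (u v : V) :
    ∃ w, w ≠ u ∧ w ≠ v := by
  classical
  have : ({u, v} : Finset V).card < (Finset.univ : Finset V).card :=
    Finset.card_le_two.trans_lt hG.1
  obtain ⟨w, -, hw⟩ := Finset.exists_mem_notMem_of_card_lt_card this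
  exact ⟨w, by simpa using hw⟩

theorem TwoConnected.preconnected [Fintype V] (hG : G.TwoConnected) : G.Preconnected := by
  intro u v
  obtain ⟨w, hu, hv⟩ := hG.exists_ne_ne u v
  obtain ⟨p, -⟩ := exists_isPath_notMem_support (hG.2 w) hu.symm hv.symm
  exact ⟨p⟩

theorem TwoConnected.hasCycleThrough_of_adj [Fintype V] (hG : G.TwoConnected) {u v : V}
    (h : G.Adj u v) : G.HasCycleThrough {u, v} := by
  classical
  obtain ⟨x, hxu, hxv⟩ := hG.exists_ne_ne u v
  obtain ⟨q, hq, hvq⟩ := exists_isPath_notMem_support (hG.2 v) h.ne hxv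
  cases q with
  | nil => exact absurd rfl hxu
  | @cons _ y _ huy q =>
    have hyv : y ≠ v := by rintro rfl; simp at hvq
    obtain ⟨p, hp, hup⟩ := exists_isPath_notMem_support (hG.2 u) h.ne' huy.ne'
    refine (HasCycleThrough.of_isPath (p := .cons h p) (hp.cons hup) ?_ huy.symm).mono ?_
    · cases p with
      | nil => exact absurd rfl hyv
      | cons => simp
    · rintro z (rfl | rfl) <;> simp

theorem Walk.exists_isPath_forall_mem_imp_eq {v u : V} (p : G.Walk v u) {s : Set V} (hu : u ∈ s) :
    ∃ x ∈ s, ∃ q : G.Walk v x, q.IsPath ∧ q.support ⊆ p.support ∧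
      ∀ y ∈ q.support, y ∈ s → y = x := by
  classical
  induction p with
  | nil => exact ⟨_, hu, .nil, by simp, by simp, by simp⟩
  | @cons a b c hab p ih =>
    by_cases ha : a ∈ s
    · exact ⟨a, ha, .nil, by simp, by simp, by simp⟩
    · obtain ⟨x, hx, q, -, hqp, hqs⟩ := ih hu
      refine ⟨x, hx, (Walk.cons hab q).bypass, Walk.bypass_isPath _, ?_, ?_⟩
      · intro y hy
        have := Walk.support_bypass_subset_support _ hy
        rw [Walk.support_cons, List.mem_cons] at this ⊢
        exact this.imp_right fun h => hqp h
      · intro y hy hys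
        have := Walk.support_bypass_subset_support _ hy
        rw [Walk.support_cons, List.mem_cons] at this
        rcases this with rfl | h
        · exact absurd hys ha
        · exact hqs y h hys

/-- The vertices lying on a common cycle with `u` are closed under adjacency. -/
theorem TwoConnected.hasCycleThrough_step [Fintype V] (hG : G.TwoConnected) {u w v : V}
    (h : G.HasCycleThrough {u, w}) (huw : u ≠ w) (hwv : G.Adj w v) :
    G.HasCycleThrough {u, v} := by
  classical
  obtain ⟨a, c₀, hc₀, hmem⟩ := h
  have hw₀ : w ∈ c₀.support := hmem w (by simp)
  obtain ⟨c, hc, hu⟩ : ∃ c : G.Walk w w, c.IsCycle ∧ u ∈ c.support :=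
    ⟨c₀.rotate w hw₀, hc₀.rotate hw₀, by
      rw [Walk.mem_support_rotate_iff]; exact hmem u (by simp)⟩
  by_cases hv : v ∈ c.support
  · exact ⟨w, c, hc, by rintro x (rfl | rfl) <;> assumption⟩
  obtain ⟨r, -, hwr⟩ := exists_isPath_notMem_support (hG.2 w) hwv.ne' huw
  obtain ⟨x, hx, q, hq, hqr, hqs⟩ :=
    r.exists_isPath_forall_mem_imp_eq (s := {y | y ∈ c.support}) hu
  have hxw : x ≠ w := by
    rintro rfl
    exact hwr (hqr q.end_mem_support)
  obtain ⟨d, hd, hdc, hud⟩ : ∃ d : G.Walk w x, d.IsPath ∧ d.support ⊆ c.support ∧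
      u ∈ d.support := by
    rw [← c.take_spec hx, Walk.mem_support_append_iff] at hu
    rcases hu with hu | hu
    · exact ⟨c.takeUntil x hx, hc.isPath_takeUntil hx,
        c.support_takeUntil_subset_support hx, hu⟩
    · refine ⟨(c.dropUntil x hx).reverse, ?_, ?_, by simpa using hu⟩
      · rw [Walk.isPath_reverse_iff]
        have := hc
        rw [← c.take_spec hx] at this
        exact this.isPath_of_append_right (Walk.not_nil_of_ne hxw.symm)
      · intro y hy
        exact c.support_dropUntil_subset_support hx (by simpa using hy)
  have hpath : (d.append q.reverse).IsPath := by
    rw [Walk.isPath_def, Walk.support_append, List.nodup_append']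
    have hqn := (Walk.isPath_def _).1 hq.reverse
    refine ⟨(Walk.isPath_def _).1 hd, hqn.tail, ?_⟩
    intro y hy hy'
    have hyx : y = x := hqs y (by
      have := List.mem_of_mem_tail hy'
      simpa using this) (hdc hy)
    subst hyx
    rw [← q.reverse.cons_tail_support, List.nodup_cons] at hqn
    exact hqn.1 hy'
  refine (HasCycleThrough.of_isPath hpath ?_ hwv.symm).mono ?_
  · have h1 : d.length ≠ 0 := fun h0 => hxw (Walk.eq_of_length_eq_zero h0).symm
    have h2 : q.length ≠ 0 := fun h0 => by
      have := Walk.eq_of_length_eq_zero h0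
      exact hv (this ▸ hx)
    rw [Walk.length_append, Walk.length_reverse]
    omega
  · rintro y (rfl | rfl)
    · simp [hud]
    · simp

/-- Any two vertices of a 2-connected graph lie on a common cycle. -/
theorem TwoConnected.hasCycleThrough_pair [Fintype V] (hG : G.TwoConnected) {u v : V}
    (huv : u ≠ v) : G.HasCycleThrough {u, v} := by
  obtain ⟨p⟩ := hG.preconnected v u
  induction p with
  | nil => exact absurd rfl huv
  | @cons v w u hvw p ih =>
    by_cases huw : u = w
    · subst huw
      exact hG.hasCycleThrough_of_adj hvw.symm
    · exact hG.hasCycleThrough_step (ih huw) huw hvw.symm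

theorem TwoConnected.hasCycleThrough_of_card_le_two [Fintype V] (hG : G.TwoConnected)
    {L : Finset V} (hL : L.card ≤ 2) : G.HasCycleThrough L := by
  classical
  obtain ⟨M, hLM, hM⟩ := Finset.exists_superset_card_eq hL ((Nat.le_succ 2).trans hG.1)
  obtain ⟨u, v, huv, rfl⟩ := Finset.card_eq_two.1 hM
  exact (hG.hasCycleThrough_pair huv).mono (by simpa [← Finset.coe_subset] using hLM)

theorem exists_not_hasBipartiteHole_bipartiteHoleNumber [Fintype V] [Nonempty V]
    (G : SimpleGraph V) :
    ∃ s t : ℕ, 0 < s ∧ 0 < t ∧ s + t = G.bipartiteHoleNumber + 1 ∧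
      ¬ G.HasBipartiteHole s t := by
  refine Nat.sInf_mem (s := {k | ∃ s t : ℕ, 0 < s ∧ 0 < t ∧ s + t = k + 1 ∧
    ¬ G.HasBipartiteHole s t}) ⟨Fintype.card V, 1, Fintype.card V, one_pos,
      Fintype.card_pos, add_comm _ _, ?_⟩
  classical
  rintro ⟨S, T, hST, hS, hT, -⟩
  have := Finset.card_le_univ (S ∪ T)
  rw [Finset.card_union_of_disjoint hST] at this
  omega

end SimpleGraph

theorem cycle_through_high_degree_vertices {V : Type*} [Fintype V] [DecidableEq V]
    (G : SimpleGraph V) [DecidableRel G.Adj] (hG : G.TwoConnected) :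
    ∃ (a : V) (c : G.Walk a a), c.IsCycle ∧
      ∀ v : V, G.bipartiteHoleNumber ≤ G.degree v → v ∈ c.support := by
  classical
  set L : Finset V := {v | G.bipartiteHoleNumber ≤ G.degree v} with hL
  suffices h : G.HasCycleThrough L by
    obtain ⟨a, c, hc, h⟩ := h
    exact ⟨a, c, hc, fun v hv => h v (by simpa [hL] using hv)⟩
  rcases Nat.lt_or_ge L.card 3 with hcard | hcard
  · exact hG.hasCycleThrough_of_card_le_two (by omega)
  have : Nonempty V := Fintype.card_pos_iff.1 (by have := hG.1; omega)
  obtain ⟨s, t, hs, ht, hst, hhole⟩ := G.exists_not_hasBipartiteHole_bipartiteHoleNumber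
  refine SimpleGraph.hasCycleThrough_of_three_le_card hs ht hcard G hhole fun v hv => ?_
  have hv : G.bipartiteHoleNumber ≤ G.degree v := by simpa [hL] using hv
  rw [← G.card_neighborSet_eq_degree, ← Nat.card_eq_fintype_card] at hv
  rw [← Nat.card_coe_set_eq]
  omega
end

section
/- Let G be a 2-connected finite simple graph. If for every pair of vertices x, y with d(x,y) = 2 and max{d_G(x), d_G(y)} < α̃(G) one has I(x,y) ≥ α₂(x,y) + 2, then G is hamiltonian. -/
/-- `N_2(x)`: the set of vertices of `G` at distance exactly 2 from `x`. -/
def SimpleGraph.distTwoSet {V : Type*} (G : SimpleGraph V) (x : V) : Set V :=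
  {v | G.dist x v = 2}

/-- `α₂(x,y)`: the independence number of the subgraph of `G` induced by
`N_2(x) ∩ N_2(y)` (which is `0` when this set is empty). -/
noncomputable def SimpleGraph.alphaTwo {V : Type*} (G : SimpleGraph V) (x y : V) : ℕ :=
  sSup {n : ℕ | ∃ s : Finset V, (↑s : Set V) ⊆ G.distTwoSet x ∩ G.distTwoSet y ∧
    (∀ a ∈ s, ∀ b ∈ s, ¬ G.Adj a b) ∧ s.card = n}

namespace SimpleGraph

variable {V : Type*} {G : SimpleGraph V}

/-- `l` lists the vertices of a path of `G` from `a` to `b`. -/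
def IsPathList (G : SimpleGraph V) (a b : V) (l : List V) : Prop :=
  l.IsChain G.Adj ∧ l.Nodup ∧ l.head? = some a ∧ l.getLast? = some b

/-- `l` lists the vertices of a cycle of `G` in cyclic order. -/
def IsCycleList (G : SimpleGraph V) (l : List V) : Prop :=
  ∃ a b, G.IsPathList a b l ∧ G.Adj b a ∧ 3 ≤ l.length

lemma getD_mem_of_lt {l : List V} (x : V) {i : ℕ} (hi : i < l.length) : l.getD i x ∈ l := by
  rw [List.getD_eq_getElem _ _ hi]
  exact List.getElem_mem hi

namespace IsPathList

variable {a b c d : V} {l m : List V}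

lemma head_mem (h : G.IsPathList a b l) : a ∈ l := List.mem_of_head? h.2.2.1

lemma last_mem (h : G.IsPathList a b l) : b ∈ l := List.mem_of_getLast? h.2.2.2

lemma ne_nil (h : G.IsPathList a b l) : l ≠ [] := List.ne_nil_of_mem h.head_mem

lemma length_pos (h : G.IsPathList a b l) : 0 < l.length := List.length_pos_of_mem h.head_mem

lemma singleton (a : V) : G.IsPathList a a [a] := by simp [IsPathList]

lemma append (h₁ : G.IsPathList a b l) (h₂ : G.IsPathList c d m) (hbc : G.Adj b c)
    (hd : l.Disjoint m) : G.IsPathList a d (l ++ m) := by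
  obtain ⟨p1, p2, p3, p4⟩ := h₁
  obtain ⟨q1, q2, q3, q4⟩ := h₂
  refine ⟨List.isChain_append.2 ⟨p1, q1, ?_⟩, List.nodup_append'.2 ⟨p2, q2, hd⟩, ?_, ?_⟩
  · simp [p4, q3, hbc]
  · simp [p3]
  · simp [q4]

lemma reverse (h : G.IsPathList a b l) : G.IsPathList b a l.reverse := by
  obtain ⟨p1, p2, p3, p4⟩ := h
  refine ⟨?_, by simpa using p2, by simpa using p4, by simpa using p3⟩
  rw [List.isChain_reverse]
  exact p1.imp fun _ _ h => h.symm

lemma of_append (h : G.IsPathList a b (l ++ m)) (hl : l ≠ []) (hm : m ≠ []) :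
    ∃ c d, G.IsPathList a c l ∧ G.IsPathList d b m ∧ G.Adj c d ∧ l.Disjoint m := by
  obtain ⟨p1, p2, p3, p4⟩ := h
  rw [List.isChain_append] at p1
  rw [List.nodup_append'] at p2
  have hc := List.getLast?_eq_some_getLast hl
  have hd := List.head?_eq_some_head hm
  refine ⟨l.getLast hl, m.head hm, ⟨p1.1, p2.1, ?_, hc⟩, ⟨p1.2.1, p2.2.1, hd, ?_⟩,
    p1.2.2 _ hc _ hd, p2.2.2⟩
  · rw [List.head?_append_of_ne_nil _ hl] at p3
    exact p3
  · rw [List.getLast?_append_of_ne_nil _ hm] at p4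
    exact p4

lemma getD_zero (h : G.IsPathList a b l) (x : V) : l.getD 0 x = a := by
  obtain ⟨-, -, p3, -⟩ := h
  cases l <;> simp_all

lemma getD_last (h : G.IsPathList a b l) (x : V) : l.getD (l.length - 1) x = b := by
  obtain ⟨-, -, -, p4⟩ := h
  rw [List.getLast?_eq_getElem?] at p4
  simp [p4]

lemma split (h : G.IsPathList a b l) (x : V) {i : ℕ} (hi : i + 1 < l.length) :
    G.IsPathList a (l.getD i x) (l.take (i + 1)) ∧
      G.IsPathList (l.getD (i + 1) x) b (l.drop (i + 1)) ∧
      G.Adj (l.getD i x) (l.getD (i + 1) x) ∧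
      (l.take (i + 1)).Disjoint (l.drop (i + 1)) := by
  have h' := h
  rw [← List.take_append_drop (i + 1) l] at h'
  obtain ⟨c, d, h1, h2, h3, h4⟩ := h'.of_append
    (List.ne_nil_of_length_pos (by simp; omega)) (List.ne_nil_of_length_pos (by simp; omega))
  have e1 := h1.getD_last x
  have e2 := h2.getD_zero x
  have e1' : l.getD i x = c := by
    rw [← e1]
    simp only [List.length_take, List.getD_eq_getElem?_getD]
    rw [List.getElem?_take_of_lt (by omega)]
    congr 2
    omega
  have e2' : l.getD (i + 1) x = d := by
    rw [← e2]
    simp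
  rw [e1', e2']
  exact ⟨h1, h2, h3, h4⟩

lemma take_succ (h : G.IsPathList a b l) (x : V) {i : ℕ} (hi : i < l.length) :
    G.IsPathList a (l.getD i x) (l.take (i + 1)) := by
  rcases Nat.lt_or_ge (i + 1) l.length with h1 | h1
  · exact (h.split x h1).1
  · rw [List.take_of_length_le h1]
    have : i = l.length - 1 := by omega
    rw [this, h.getD_last x]
    exact h

lemma drop_take_succ (h : G.IsPathList a b l) (x : V) {i j : ℕ} (hij : i ≤ j)
    (hj : j < l.length) :
    G.IsPathList (l.getD i x) (l.getD j x) ((l.take (j + 1)).drop i) := by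
  have key := h.take_succ x hj
  rcases i with _ | i
  · rw [h.getD_zero x, List.drop_zero]
    exact key
  · have := (key.split x (i := i) (by simp; omega)).2.1
    convert this using 1
    simp only [List.getD_eq_getElem?_getD]
    rw [List.getElem?_take_of_lt (by omega)]

lemma getD_inj (h : G.IsPathList a b l) (x : V) {i j : ℕ} (hi : i < l.length) (hj : j < l.length)
    (hij : l.getD i x = l.getD j x) : i = j := by
  rw [List.getD_eq_getElem _ _ hi, List.getD_eq_getElem _ _ hj] at hij
  exact (h.2.1.getElem_inj_iff).1 hij

lemma isCycleList (h : G.IsPathList a b l) (hba : G.Adj b a) (hl : 3 ≤ l.length) :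
    G.IsCycleList l := ⟨a, b, h, hba, hl⟩

end IsPathList

namespace IsCycleList

lemma of_three {a₁ b₁ a₂ b₂ a₃ b₃ : V} {l₁ l₂ l₃ : List V} (h₁ : G.IsPathList a₁ b₁ l₁)
    (h₂ : G.IsPathList a₂ b₂ l₂) (h₃ : G.IsPathList a₃ b₃ l₃) (h₁₂ : G.Adj b₁ a₂)
    (h₂₃ : G.Adj b₂ a₃) (h₃₁ : G.Adj b₃ a₁) (d₁₂ : l₁.Disjoint l₂) (d₁₃ : l₁.Disjoint l₃)
    (d₂₃ : l₂.Disjoint l₃) : G.IsCycleList (l₁ ++ (l₂ ++ l₃)) := by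
  refine ⟨a₁, b₃, h₁.append (h₂.append h₃ h₂₃ d₂₃) h₁₂ ?_, h₃₁, ?_⟩
  · exact List.disjoint_append_right.2 ⟨d₁₂, d₁₃⟩
  · have := h₁.length_pos
    have := h₂.length_pos
    have := h₃.length_pos
    simp
    omega

lemma rotate {l m : List V} (h : G.IsCycleList (l ++ m)) : G.IsCycleList (m ++ l) := by
  obtain ⟨a, b, h1, h2, h3⟩ := h
  rcases eq_or_ne l [] with rfl | hl
  · exact ⟨a, b, by simpa using h1, h2, by simpa using h3⟩
  rcases eq_or_ne m [] with rfl | hm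
  · exact ⟨a, b, by simpa using h1, h2, by simpa using h3⟩
  obtain ⟨c, d, p1, p2, p3, p4⟩ := h1.of_append hl hm
  exact ⟨d, c, p2.append p1 h2 p4.symm, p3, by simp at h3 ⊢; omega⟩

lemma isHamiltonian [Fintype V] [DecidableEq V] {l : List V} (h : G.IsCycleList l)
    (hl : ∀ v, v ∈ l) : G.IsHamiltonian := by
  have key : ∀ (l : List V) (a b : V), G.IsPathList a b l →
      ∃ p : G.Walk a b, p.support = l := by
    intro l
    induction l with
    | nil => intro a b h; exact absurd rfl h.ne_nil
    | cons x l ih =>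
      intro a b h
      have hx : x = a := by simpa using h.2.2.1
      subst hx
      rcases eq_or_ne l [] with rfl | hne
      · have hb : x = b := by simpa using h.2.2.2
        subst hb
        exact ⟨.nil, rfl⟩
      · obtain ⟨c, d, h1, h2, h3, -⟩ := IsPathList.of_append (l := [x]) (m := l) h (by simp) hne
        obtain ⟨p, hp⟩ := ih d b h2
        have hc : x = c := by simpa using h1.2.2.2
        subst hc
        exact ⟨.cons h3 p, by simp [hp]⟩
  obtain ⟨a, b, h1, h2, h3⟩ := h
  obtain ⟨p, hp⟩ := key l a b h1
  have hpath : p.IsPath := Walk.IsPath.mk' (hp ▸ h1.2.1)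
  have hlen := p.length_support
  rw [hp] at hlen
  intro _
  refine ⟨b, .cons h2 p, Walk.isHamiltonianCycle_iff_isCycle_and_support_count_tail_eq_one.2
    ⟨(Walk.cons_isCycle_iff p h2).2 ⟨hpath, fun he => ?_⟩, fun v => ?_⟩⟩
  · rw [Sym2.eq_swap] at he
    have := hpath.length_eq_one_of_mem_edges he
    omega
  · rw [Walk.support_cons, List.tail_cons, hp]
    exact List.count_eq_one_of_mem h1.2.1 (hl v)

end IsCycleList

lemma exists_isPathList_of_isPath (C : Set V) {x u : V} (p : G.Walk x u) (hp : p.IsPath)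
    (hx : x ∉ C) (hu : u ∈ C) :
    ∃ y w l, G.IsPathList x y l ∧ (∀ z ∈ l, z ∉ C) ∧ w ∈ C ∧ G.Adj y w ∧ w ∈ p.support ∧
      ∀ z ∈ l, z ∈ p.support := by
  induction p with
  | nil => exact absurd hu hx
  | @cons x y u hxy p ih =>
    rw [Walk.cons_isPath_iff] at hp
    by_cases hy : y ∈ C
    · exact ⟨x, y, [x], .singleton x, by simpa using hx, hy, hxy, by simp, by simp⟩
    · obtain ⟨z, w, l, h1, h2, h3, h4, h5, h6⟩ := ih hp.1 hy hu
      refine ⟨z, w, [x] ++ l, (IsPathList.singleton x).append h1 hxy ?_, ?_, h3, h4, ?_, ?_⟩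
      · simpa using fun h => hp.2 (h6 x h)
      · simpa using ⟨hx, h2⟩
      · simp [h5]
      · simp only [List.singleton_append, List.mem_cons, Walk.support_cons]
        rintro z (rfl | hz)
        · exact Or.inl rfl
        · exact Or.inr (h6 z hz)

namespace TwoConnected

variable [Fintype V]

lemma exists_path_to (hG : G.TwoConnected) {C : Set V} {v x : V} (hv : v ∈ C) (hx : x ∉ C)
    (hu : ∃ u ∈ C, u ≠ v) :
    ∃ y w l, G.IsPathList x y l ∧ (∀ z ∈ l, z ∉ C) ∧ w ∈ C ∧ w ≠ v ∧ G.Adj y w := by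
  classical
  obtain ⟨u, huC, huv⟩ := hu
  have hxv : x ≠ v := fun h => hx (h ▸ hv)
  obtain ⟨p⟩ := (hG.2 v).preconnected ⟨x, hxv⟩ ⟨u, huv⟩
  have hp : (p.toPath.1.map (Embedding.induce {u | u ≠ v}).toHom).IsPath :=
    p.toPath.2.map (Embedding.induce (G := G) {u | u ≠ v}).injective
  obtain ⟨y, w, l, h1, h2, h3, h4, h5, -⟩ := exists_isPathList_of_isPath C _ hp hx huC
  refine ⟨y, w, l, h1, h2, h3, ?_, h4⟩
  rw [Walk.support_map, List.mem_map] at h5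
  obtain ⟨w', -, rfl⟩ := h5
  exact w'.2

lemma exists_adj_ne (hG : G.TwoConnected) {w x : V} (hwx : w ≠ x) : ∃ z, z ≠ x ∧ G.Adj w z := by
  classical
  obtain ⟨y, hy⟩ : ∃ y, y ∉ ({w, x} : Finset V) := by
    by_contra! hc
    have h1 : (Finset.univ : Finset V) ⊆ {w, x} := fun a _ => hc a
    have h2 := Finset.card_le_card h1
    have h3 := Finset.card_le_two (a := w) (b := x)
    have h4 := hG.1
    rw [Finset.card_univ] at h2
    omega
  simp only [Finset.mem_insert, Finset.mem_singleton, not_or] at hy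
  obtain ⟨a, z, l, h1, h2, h3, h4, h5⟩ := hG.exists_path_to (C := {w}ᶜ) (v := x) (x := w)
    (by simpa using hwx.symm) (by simp) ⟨y, by simpa using hy.1, hy.2⟩
  have := h2 a h1.last_mem
  simp only [Set.mem_compl_iff, Set.mem_singleton_iff, not_not] at this
  exact ⟨z, h4, this ▸ h5⟩

lemma exists_isCycleList_of_adj (hG : G.TwoConnected) {x w : V} (h : G.Adj x w) :
    ∃ l, G.IsCycleList l ∧ x ∈ l ∧ w ∈ l := by
  obtain ⟨z, hz, hwz⟩ := hG.exists_adj_ne h.ne'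
  obtain ⟨y, u, l, h1, h2, h3, h4, h5⟩ := hG.exists_path_to (C := {v | v = w ∨ G.Adj w v ∧ v ≠ x})
    (v := w) (x := x) (Or.inl rfl) (by simp [h.ne]) ⟨z, Or.inr ⟨hwz, hz⟩, hwz.ne'⟩
  have hu : G.Adj w u ∧ u ≠ x := h3.resolve_left h4
  refine ⟨_, IsCycleList.of_three (.singleton w) h1 (.singleton u) h.symm h5 hu.1.symm ?_ ?_ ?_,
    ?_, ?_⟩
  · simpa using fun hw => h2 w hw (Or.inl rfl)
  · simpa using h4
  · simpa using fun hw => h2 u hw h3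
  · simp [h1.head_mem]
  · simp

end TwoConnected

lemma HasBipartiteHole.mono {s t : ℕ} {S T : Finset V} (hd : Disjoint S T) (hs : s ≤ S.card)
    (ht : t ≤ T.card) (h : ∀ a ∈ S, ∀ b ∈ T, ¬ G.Adj a b) : G.HasBipartiteHole s t := by
  obtain ⟨S', h1, h2⟩ := Finset.exists_subset_card_eq hs
  obtain ⟨T', h3, h4⟩ := Finset.exists_subset_card_eq ht
  exact ⟨S', T', Finset.disjoint_of_subset_left h1 (Finset.disjoint_of_subset_right h3 hd),
    h2, h4, fun a ha b hb => h a (h1 ha) b (h3 hb)⟩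

lemma exists_not_hasBipartiteHole [Fintype V] :
    ∃ s t, 0 < s ∧ 0 < t ∧ s + t = G.bipartiteHoleNumber + 1 ∧ ¬ G.HasBipartiteHole s t := by
  refine Nat.sInf_mem (s := {k : ℕ | ∃ s t : ℕ, 0 < s ∧ 0 < t ∧ s + t = k + 1 ∧
    ¬ G.HasBipartiteHole s t}) ⟨Fintype.card V + 1, 1, Fintype.card V + 1, by omega, by omega,
    by omega, ?_⟩
  rintro ⟨S, T, -, -, hT, -⟩
  have := T.card_le_univ
  omega

namespace IsPathList

variable {a b : V} {l : List V}

variable [Fintype V] [DecidableEq V] [DecidableRel G.Adj]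

/-- The neighbours of `a` off the list `l`. -/
abbrev outer (G : SimpleGraph V) [DecidableRel G.Adj] (l : List V) (a : V) : Finset V :=
  G.neighborFinset a \ l.toFinset

/-- The positions in `l` of the neighbours of `a`. -/
abbrev inner (G : SimpleGraph V) [DecidableRel G.Adj] (l : List V) (x a : V) : Finset ℕ :=
  (Finset.range l.length).filter fun i => G.Adj a (l.getD i x)

lemma degree_le (l : List V) (x a : V) :
    G.degree a ≤ (outer G l a).card + (inner G l x a).card := by
  have : G.neighborFinset a ⊆ outer G l a ∪ (inner G l x a).image fun i => l.getD i x := by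
    intro v hv
    by_cases hvl : v ∈ l
    · obtain ⟨i, hi, rfl⟩ := List.mem_iff_getElem.1 hvl
      refine Finset.mem_union_right _ (Finset.mem_image.2 ⟨i, ?_, by simp [hi]⟩)
      simpa [hi] using hv
    · exact Finset.mem_union_left _ (by simpa [hvl] using hv)
  calc G.degree a = (G.neighborFinset a).card := rfl
    _ ≤ _ := Finset.card_le_card this
    _ ≤ _ := Finset.card_union_le _ _
    _ ≤ _ := Nat.add_le_add_left Finset.card_image_le _

/-- The two endpoints of a path have large degree and there is no `(s, t)`-bipartite-hole, so some
cycle passes through all vertices of the path. -/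
lemma exists_isCycleList_of_degree (h : G.IsPathList a b l) (hl : 3 ≤ l.length) {s t : ℕ}
    (hno : ¬ G.HasBipartiteHole s t) (hs : 0 < s) (ht : 0 < t)
    (ha : s + t ≤ G.degree a + 1) (hb : s + t ≤ G.degree b + 1) : ∃ l', G.IsCycleList l' ∧ l ⊆ l' := by
  by_contra! hcon
  have hba : ¬ G.Adj b a := fun hba => hcon l (h.isCycleList hba hl) (List.Subset.refl l)
  set q : ℕ → V := fun i => l.getD i a with hq
  set X := outer G l a
  set Y := outer G l b
  set I := inner G l a a
  set J := inner G l a b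
  have hqa : q 0 = a := h.getD_zero a
  have hqb : q (l.length - 1) = b := h.getD_last a
  have hI : ∀ i ∈ I, 0 < i ∧ i + 1 < l.length ∧ G.Adj a (q i) := by
    intro i hi
    obtain ⟨h1, h2⟩ := Finset.mem_filter.1 hi
    rw [Finset.mem_range] at h1
    refine ⟨Nat.pos_of_ne_zero ?_, ?_, h2⟩
    · rintro rfl
      change G.Adj a (q 0) at h2
      exact h2.ne hqa.symm
    · by_contra hc
      have : i = l.length - 1 := by omega
      subst this
      change G.Adj a (q _) at h2
      rw [hqb] at h2
      exact hba h2.symm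
  have hJ : ∀ i ∈ J, 0 < i ∧ i + 1 < l.length ∧ G.Adj b (q i) := by
    intro i hi
    obtain ⟨h1, h2⟩ := Finset.mem_filter.1 hi
    rw [Finset.mem_range] at h1
    refine ⟨Nat.pos_of_ne_zero ?_, ?_, h2⟩
    · rintro rfl
      change G.Adj b (q 0) at h2
      rw [hqa] at h2
      exact hba h2
    · by_contra hc
      have : i = l.length - 1 := by omega
      subst this
      change G.Adj b (q _) at h2
      exact h2.ne hqb.symm
  have hX : ∀ z ∈ X, G.Adj a z ∧ z ∉ l := fun z hz => by simpa [X] using hz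
  have hY : ∀ z ∈ Y, G.Adj b z ∧ z ∉ l := fun z hz => by simpa [Y] using hz
  have cX : s + t ≤ X.card + I.card + 1 := by
    have : G.degree a ≤ X.card + I.card := degree_le l a a
    omega
  have cY : s + t ≤ Y.card + J.card + 1 := by
    have : G.degree b ≤ Y.card + J.card := degree_le l a b
    omega
  have qinj : ∀ i j, i < l.length → j < l.length → q i = q j → i = j :=
    fun i j hi hj => h.getD_inj a hi hj
  have qmem : ∀ i, i < l.length → q i ∈ l := fun i hi => getD_mem_of_lt a hi
  have hXY : ∀ z, z ∈ X → z ∉ Y := fun z hz hz' =>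
    hcon ([z] ++ l) (((IsPathList.singleton z).append h (hX z hz).1.symm
      (by simpa using (hX z hz).2)).isCycleList (hY z hz').1 (by simp; omega))
      (List.subset_append_right _ _)
  have hdisj : ∀ i j, i ≤ j → (l.take i).Disjoint (l.drop j) := fun i j hij =>
    List.disjoint_take_drop h.2.1 hij
  have hB : ∀ i j z, z ∈ (l.take j).drop i → z ∈ l.take j ∧ z ∈ l.drop i := fun i j z hz =>
    ⟨List.mem_of_mem_drop hz, List.mem_of_mem_take (List.drop_take ▸ hz)⟩
  have hcover : ∀ i j z, i ≤ j → z ∈ l →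
      z ∈ l.take i ∨ z ∈ (l.take j).drop i ∨ z ∈ l.drop j := by
    intro i j z hij hz
    rw [← List.take_append_drop j l, List.mem_append, ← List.take_append_drop i (l.take j),
      List.mem_append, List.take_take, min_eq_left hij] at hz
    tauto
  have hm : ∃ m, s ≤ X.card + (I.filter (· ≤ m)).card ∧ m < l.length ∧
      ∀ n < m, X.card + (I.filter (· ≤ n)).card < s := by
    have hlast : t + s ≤ X.card + (I.filter (· ≤ l.length - 1)).card + 1 := by
      rw [Finset.filter_true_of_mem fun i hi => by have := hI i hi; omega]
      omega
    have hex : ∃ m, s ≤ X.card + (I.filter (· ≤ m)).card := ⟨l.length - 1, by omega⟩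
    refine ⟨Nat.find hex, Nat.find_spec hex, ?_, fun n hn => not_le.1 (Nat.find_min hex hn)⟩
    have := Nat.find_min' hex (m := l.length - 1) (by omega)
    omega
  obtain ⟨m, hm1, hm2, hm3⟩ := hm
  by_cases hT : t ≤ Y.card + (J.filter (m ≤ ·)).card
  · set I' := (I.filter (· ≤ m)).image fun i => q (i - 1)
    set J' := (J.filter (m ≤ ·)).image fun j => q (j + 1)
    have hI' : ∀ z ∈ I', ∃ i ∈ I, i ≤ m ∧ q (i - 1) = z := fun z hz => by
      simpa [I', and_assoc] using hz
    have hJ' : ∀ z ∈ J', ∃ j ∈ J, m ≤ j ∧ q (j + 1) = z := fun z hz => by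
      simpa [J', and_assoc] using hz
    have hI'l : ∀ z ∈ I', z ∈ l := by
      intro z hz
      obtain ⟨i, hi, -, rfl⟩ := hI' z hz
      exact qmem _ (by have := hI i hi; omega)
    have hJ'l : ∀ z ∈ J', z ∈ l := by
      intro z hz
      obtain ⟨i, hi, -, rfl⟩ := hJ' z hz
      exact qmem _ (by have := hJ i hi; omega)
    have cI' : I'.card = (I.filter (· ≤ m)).card := by
      refine Finset.card_image_of_injOn fun i hi j hj hij => ?_
      have hi := hI i (Finset.mem_filter.1 hi).1
      have hj := hI j (Finset.mem_filter.1 hj).1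
      have := qinj _ _ (by omega) (by omega) hij
      omega
    have cJ' : J'.card = (J.filter (m ≤ ·)).card := by
      refine Finset.card_image_of_injOn fun i hi j hj hij => ?_
      have hi := hJ i (Finset.mem_filter.1 hi).1
      have hj := hJ j (Finset.mem_filter.1 hj).1
      have := qinj _ _ (by omega) (by omega) hij
      omega
    have hleft : ∀ u ∈ X ∪ I', ∃ c A i, G.IsPathList c u A ∧ G.Adj c (q i) ∧ i ≤ m ∧
        (∀ z ∈ A, z ∈ l.take i ∨ z ∈ X) ∧ l.take i ⊆ A := by
      intro u hu
      rcases Finset.mem_union.1 hu with hu | hu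
      · exact ⟨u, [u], 0, .singleton u, hqa.symm ▸ (hX u hu).1.symm, by omega, by simpa using hu,
          by simp⟩
      · obtain ⟨i, hi, him, rfl⟩ := hI' u hu
        obtain ⟨h1, h2, h3⟩ := hI i hi
        refine ⟨a, l.take i, i, ?_, h3, him, fun z hz => Or.inl hz, List.Subset.refl _⟩
        have := h.take_succ a (i := i - 1) (by omega)
        rwa [Nat.sub_add_cancel h1] at this
    have hright : ∀ w ∈ Y ∪ J', ∃ d C j, G.IsPathList w d C ∧ G.Adj (q j) d ∧ m ≤ j ∧
        j < l.length ∧ (∀ z ∈ C, z ∈ l.drop (j + 1) ∨ z ∈ Y) ∧ l.drop (j + 1) ⊆ C := by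
      intro w hw
      rcases Finset.mem_union.1 hw with hw | hw
      · refine ⟨w, [w], l.length - 1, .singleton w, hqb.symm ▸ (hY w hw).1, by omega, by omega,
          by simpa using Or.inr hw, ?_⟩
        rw [List.drop_of_length_le (by omega)]
        simp
      · obtain ⟨j, hj, hjm, rfl⟩ := hJ' w hw
        obtain ⟨h1, h2, h3⟩ := hJ j hj
        exact ⟨b, l.drop (j + 1), j, (h.split a h2).2.1, h3.symm, hjm, by omega,
          fun z hz => Or.inl hz, List.Subset.refl _⟩
    refine hno (.mono (S := X ∪ I') (T := Y ∪ J') ?_ ?_ ?_ ?_)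
    · rw [Finset.disjoint_left]
      intro z hz hz'
      rcases Finset.mem_union.1 hz with hz | hz <;> rcases Finset.mem_union.1 hz' with hz' | hz'
      · exact hXY z hz hz'
      · exact (hX z hz).2 (hJ'l z hz')
      · exact (hY z hz').2 (hI'l z hz)
      · obtain ⟨i, hi, him, rfl⟩ := hI' z hz
        obtain ⟨j, hj, hjm, hij⟩ := hJ' _ hz'
        have hi := hI i hi
        have hj := hJ j hj
        have := qinj _ _ (by omega) (by omega) hij
        omega
    · rw [Finset.card_union_of_disjoint, cI']
      · exact hm1
      · exact Finset.disjoint_left.2 fun z hz hz' => (hX z hz).2 (hI'l z hz')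
    · rw [Finset.card_union_of_disjoint, cJ']
      · exact hT
      · exact Finset.disjoint_left.2 fun z hz hz' => (hY z hz).2 (hJ'l z hz')
    · intro u hu w hw huw
      obtain ⟨c, A, i, a1, a2, a3, a4, a5⟩ := hleft u hu
      obtain ⟨d, C, j, c1, c2, c3, c4, c5, c6⟩ := hright w hw
      have hmid := h.drop_take_succ a (a3.trans c3) c4
      refine hcon _ (IsCycleList.of_three a1.reverse hmid c1.reverse a2 c2 huw.symm ?_ ?_ ?_) ?_
      · intro z hz hz'
        have hz' := hB _ _ _ hz'
        rcases a4 z (List.mem_reverse.1 hz) with hz | hz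
        · exact hdisj _ _ le_rfl hz hz'.2
        · exact (hX z hz).2 (List.mem_of_mem_take hz'.1)
      · intro z hz hz'
        rcases a4 z (List.mem_reverse.1 hz) with hz | hz <;>
          rcases c5 z (List.mem_reverse.1 hz') with hz' | hz'
        · exact hdisj _ _ (by omega) hz hz'
        · exact (hY z hz').2 (List.mem_of_mem_take hz)
        · exact (hX z hz).2 (List.mem_of_mem_drop hz')
        · exact hXY z hz hz'
      · intro z hz hz'
        have hz := hB _ _ _ hz
        rcases c5 z (List.mem_reverse.1 hz') with hz' | hz'
        · exact hdisj _ _ le_rfl hz.1 hz'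
        · exact (hY z hz').2 (List.mem_of_mem_take hz.1)
      · intro z hz
        have hz := hcover i (j + 1) z (by omega) hz
        simp only [List.mem_append, List.mem_reverse]
        exact hz.imp (a5 ·) (Or.imp_right (c6 ·))
  · have hJs : s ≤ (J.filter (· < m)).card := by
      have := Finset.card_filter_add_card_filter_not (s := J) (m ≤ ·)
      simp only [not_le] at this
      omega
    have hIt : t ≤ (I.filter (m ≤ ·)).card := by
      have hm0 : m ≠ 0 := by
        rintro rfl
        simp at hJs
        omega
      have h1 := hm3 (m - 1) (by omega)
      have h2 := Finset.card_filter_add_card_filter_not (s := I) (m ≤ ·)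
      have h3 : I.filter (· ≤ m - 1) = I.filter (¬ m ≤ ·) :=
        Finset.filter_congr fun i _ => by omega
      rw [h3] at h1
      omega
    refine hno (.mono (S := (J.filter (· < m)).image fun j => q (j + 1))
      (T := (I.filter (m ≤ ·)).image fun i => q (i + 1)) ?_ ?_ ?_ ?_)
    · rw [Finset.disjoint_left]
      intro z hz hz'
      simp only [Finset.mem_image, Finset.mem_filter] at hz hz'
      obtain ⟨j, ⟨hj, hjm⟩, rfl⟩ := hz
      obtain ⟨i, ⟨hi, him⟩, hij⟩ := hz'
      have hi := hI i hi
      have hj := hJ j hj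
      have := qinj _ _ (by omega) (by omega) hij
      omega
    · rwa [Finset.card_image_of_injOn]
      intro i hi j hj hij
      have hi := hJ i (Finset.mem_filter.1 hi).1
      have hj := hJ j (Finset.mem_filter.1 hj).1
      have := qinj _ _ (by omega) (by omega) hij
      omega
    · rwa [Finset.card_image_of_injOn]
      intro i hi j hj hij
      have hi := hI i (Finset.mem_filter.1 hi).1
      have hj := hI j (Finset.mem_filter.1 hj).1
      have := qinj _ _ (by omega) (by omega) hij
      omega
    · intro u hu w hw huw
      simp only [Finset.mem_image, Finset.mem_filter] at hu hw
      obtain ⟨j, ⟨hj, hjm⟩, rfl⟩ := hu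
      obtain ⟨i, ⟨hi, him⟩, rfl⟩ := hw
      have hi := hI i hi
      have hj := hJ j hj
      have hmid := h.drop_take_succ a (i := j + 1) (j := i) (by omega) (by omega)
      refine hcon _ (IsCycleList.of_three (h.split a hj.2.1).1 (h.split a hi.2.1).2.1.reverse hmid
        hj.2.2.symm huw.symm hi.2.2.symm ?_ ?_ ?_) ?_
      · intro z hz hz'
        exact hdisj _ _ (by omega) hz (List.mem_reverse.1 hz')
      · intro z hz hz'
        exact hdisj _ _ le_rfl hz (hB _ _ _ hz').2
      · intro z hz hz'
        exact hdisj _ _ le_rfl (hB _ _ _ hz').1 (List.mem_reverse.1 hz)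
      · intro z hz
        have hz := hcover (j + 1) (i + 1) z (by omega) hz
        simp only [List.mem_append, List.mem_reverse]
        tauto

end IsPathList

lemma IsPathList.exists_trim {a b : V} {l : List V} (h : G.IsPathList a b l) (P : V → Prop)
    (ha : P a) : ∃ c m, G.IsPathList a c m ∧ P c ∧ ∀ z ∈ l, P z → z ∈ m := by
  classical
  obtain ⟨m, r, rfl, hm, hr⟩ : ∃ m r, l = m ++ r ∧ (∀ hm : m ≠ [], P (m.getLast hm)) ∧
      ∀ z ∈ r, ¬ P z := by
    refine ⟨l.rdropWhile fun z => ¬ P z, l.rtakeWhile fun z => ¬ P z,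
      List.rdropWhile_append_rtakeWhile.symm, fun hm => ?_, fun z hz => ?_⟩
    · simpa using List.rdropWhile_last_not _ _ hm
    · simpa using List.mem_rtakeWhile_imp hz
  have hne : m ≠ [] := by
    rintro rfl
    exact hr a h.head_mem ha
  have hmem : ∀ z ∈ m ++ r, P z → z ∈ m := fun z hz hP =>
    (List.mem_append.1 hz).resolve_right fun hz => hr z hz hP
  rcases eq_or_ne r [] with rfl | hr0
  · rw [List.append_nil] at h
    have hb : m.getLast hne = b := by
      have := h.2.2.2
      rwa [List.getLast?_eq_some_getLast hne, Option.some_inj] at this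
    exact ⟨b, m, h, hb ▸ hm hne, hmem⟩
  · obtain ⟨c, d, h1, -, -, -⟩ := h.of_append hne hr0
    have hc : m.getLast hne = c := by
      have := h1.2.2.2
      rwa [List.getLast?_eq_some_getLast hne, Option.some_inj] at this
    exact ⟨c, m, h1, hc ▸ hm hne, hmem⟩

lemma dist_eq_two_of_common_neighbor {x y z : V} (hne : x ≠ y) (hxy : ¬ G.Adj x y)
    (hxz : G.Adj x z) (hzy : G.Adj z y) : G.dist x y = 2 := by
  have h1 : G.dist x y ≤ 2 := dist_le (Walk.cons hxz (Walk.cons hzy .nil))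
  have h2 := (hxz.reachable.trans hzy.reachable).one_lt_dist_of_ne_of_not_adj hne hxy
  omega

lemma IsCycleList.exists_rotate_head {l : List V} (h : G.IsCycleList l) {w : V} (hw : w ∈ l) :
    ∃ m c, (∀ z, z ∈ m ↔ z ∈ l) ∧ G.IsPathList w c m ∧ G.IsCycleList m := by
  obtain ⟨l₁, l₂, rfl⟩ := List.append_of_mem hw
  have hc := h.rotate
  obtain ⟨a, c, h1, h2, h3⟩ := hc
  have : w = a := by simpa using h1.2.2.1
  subst this
  exact ⟨_, c, fun z => by simp only [List.mem_append]; tauto, h1, h1.isCycleList h2 h3⟩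

variable [Fintype V]

lemma card_le_alphaTwo {x y : V} {s : Finset V} (hx : ∀ z ∈ s, G.dist x z = 2)
    (hy : ∀ z ∈ s, G.dist y z = 2) (hs : ∀ a ∈ s, ∀ b ∈ s, ¬ G.Adj a b) :
    s.card ≤ G.alphaTwo x y := by
  refine le_csSup ⟨Fintype.card V, ?_⟩ ⟨s, fun z hz => ⟨hx z hz, hy z hz⟩, hs, rfl⟩
  rintro _ ⟨t, -, -, rfl⟩
  exact t.card_le_univ

variable [DecidableEq V] [DecidableRel G.Adj]

lemma TwoConnected.exists_isCycleList_of_le_degree (hG : G.TwoConnected) {a b : V} {l : List V}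
    (h : G.IsPathList a b l) (ha : G.bipartiteHoleNumber ≤ G.degree a)
    (hb : G.bipartiteHoleNumber ≤ G.degree b) : ∃ l', G.IsCycleList l' ∧ l ⊆ l' := by
  rcases Nat.lt_or_ge l.length 3 with hl | hl
  · obtain ⟨h1, h2, h3, h4⟩ := h
    match l, hl with
    | [], _ => simp at h3
    | [x], _ =>
      have : Nontrivial V := Fintype.one_lt_card_iff_nontrivial.1 (by have := hG.1; omega)
      obtain ⟨y, hy⟩ := exists_ne x
      obtain ⟨z, -, hz⟩ := hG.exists_adj_ne hy.symm
      obtain ⟨l', p1, p2, -⟩ := hG.exists_isCycleList_of_adj hz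
      exact ⟨l', p1, by simpa using p2⟩
    | [x, y], _ =>
      obtain ⟨l', p1, p2, p3⟩ := hG.exists_isCycleList_of_adj (x := x) (w := y) (by simpa using h1)
      exact ⟨l', p1, by simp [p2, p3]⟩
  · obtain ⟨s, t, hs, ht, hst, hno⟩ := G.exists_not_hasBipartiteHole
    exact h.exists_isCycleList_of_degree hl hno hs ht (by omega) (by omega)

/-- The successor on a maximal cycle of a neighbour of a vertex `x` off the cycle has degree at
least the bipartite-hole-number. -/
lemma IsPathList.le_degree_of_adj_last
    (hG : ∀ x y : V, G.dist x y = 2 →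
      max (G.degree x) (G.degree y) < G.bipartiteHoleNumber →
      G.alphaTwo x y + 2 ≤ (G.neighborFinset x ∩ G.neighborFinset y).card)
    {a b x : V} {l : List V} (h : G.IsPathList a b l) (hba : G.Adj b a)
    (hmax : ∀ l', G.IsCycleList l' → l ⊆ l' → l' ⊆ l)
    (hlarge : ∀ v, G.bipartiteHoleNumber ≤ G.degree v → v ∈ l) (hx : x ∉ l) (hxb : G.Adj x b) :
    G.bipartiteHoleNumber ≤ G.degree a := by
  by_contra! ha
  have hxd : G.degree x < G.bipartiteHoleNumber := not_le.1 fun hc => hx (hlarge x hc)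
  have hext : ∀ l', G.IsCycleList l' → x ∈ l' → ¬ l ⊆ l' := fun l' h1 h2 h3 => hx (hmax l' h1 h3 h2)
  set q : ℕ → V := fun i => l.getD i a with hq
  have hqa : q 0 = a := h.getD_zero a
  have hqb : q (l.length - 1) = b := h.getD_last a
  have qinj : ∀ i j, i < l.length → j < l.length → q i = q j → i = j :=
    fun i j hi hj => h.getD_inj a hi hj
  have qmem : ∀ i, i < l.length → q i ∈ l := fun i hi => getD_mem_of_lt a hi
  have hpos := h.length_pos
  have hxa : x ≠ a := fun hc => hx (hc ▸ h.head_mem)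
  have hab : 2 ≤ l.length := by
    by_contra! hc
    have : l.length - 1 = 0 := by omega
    rw [this, hqa] at hqb
    exact hba.ne hqb.symm
  have hxl : ∀ m : List V, m ⊆ l → m.Disjoint [x] := fun m hm z hz hz' =>
    hx (List.mem_singleton.1 hz' ▸ hm hz)
  have hxl' : ∀ m : List V, m ⊆ l → [x].Disjoint m := fun m hm => (hxl m hm).symm
  have htake : ∀ i, l.take i ⊆ l := fun i => List.take_subset i l
  have hdrop : ∀ i, l.drop i ⊆ l := fun i => List.drop_subset i l
  have hdisj : ∀ i j, i ≤ j → (l.take i).Disjoint (l.drop j) := fun i j hij =>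
    List.disjoint_take_drop h.2.1 hij
  have hcover : ∀ i z, z ∈ l → z ∈ l.take i ∨ z ∈ l.drop i := fun i z hz => by
    rwa [← List.take_append_drop i l, List.mem_append] at hz
  have hB : ∀ i j z, z ∈ (l.take j).drop i → z ∈ l.take j ∧ z ∈ l.drop i := fun i j z hz =>
    ⟨List.mem_of_mem_drop hz, List.mem_of_mem_take (List.drop_take ▸ hz)⟩
  have not_adj_head : ¬ G.Adj x a := fun hc =>
    hext _ ((h.append (.singleton x) hxb.symm (hxl l (List.Subset.refl l))).isCycleList hc
      (by simp; omega)) (by simp) (List.subset_append_left _ _)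
  have common_mem : ∀ u, G.Adj x u → G.Adj a u → u ∈ l := by
    intro u h1 h2
    by_contra hu
    refine hext _ (IsCycleList.of_three h (.singleton x) (.singleton u) hxb.symm h1 h2.symm
      (hxl l (List.Subset.refl l)) ?_ ?_) (by simp) (List.subset_append_left _ _)
    · simpa using hu
    · simpa using h1.ne'
  have not_adj_succ : ∀ i, i + 1 < l.length → G.Adj x (q i) → ¬ G.Adj x (q (i + 1)) := by
    intro i hi h1 h2
    obtain ⟨p1, p2, -, p4⟩ := h.split a hi
    refine hext _ (IsCycleList.of_three p1 (.singleton x) p2 h1.symm h2 hba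
      (hxl _ (htake _)) p4 (hxl' _ (hdrop _))) (by simp) fun z hz => ?_
    have := hcover (i + 1) z hz
    simp only [List.mem_append]
    tauto
  have head_not_adj_succ : ∀ i, i + 1 < l.length → G.Adj x (q i) → ¬ G.Adj a (q (i + 1)) := by
    intro i hi h1 h2
    obtain ⟨p1, p2, -, p4⟩ := h.split a hi
    refine hext _ (IsCycleList.of_three p1.reverse p2 (.singleton x) h2 hxb.symm h1
      ?_ (hxl _ ?_) (hxl _ (hdrop _))) (by simp) fun z hz => ?_
    · intro z hz
      exact p4 (List.mem_reverse.1 hz)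
    · intro z hz
      exact htake _ (List.mem_reverse.1 hz)
    · have := hcover (i + 1) z hz
      simp only [List.mem_append, List.mem_reverse]
      tauto
  have succ_not_adj_succ : ∀ i j, i < j → j + 1 < l.length → G.Adj x (q i) → G.Adj x (q j) →
      ¬ G.Adj (q (i + 1)) (q (j + 1)) := by
    intro i j hij hj h1 h2 h3
    obtain ⟨p1, -, -, -⟩ := h.split a (i := i) (by omega)
    obtain ⟨-, p2, -, -⟩ := h.split a hj
    have hmid := h.drop_take_succ a (i := i + 1) (j := j) (by omega) (by omega)
    have hd : ((l.take (j + 1)).drop (i + 1)).reverse ⊆ l := fun z hz =>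
      htake _ (hB _ _ _ (List.mem_reverse.1 hz)).1
    refine hext _ (IsCycleList.of_three (p1.append (.singleton x) h1.symm (hxl _ (htake _)))
      hmid.reverse p2 h2 h3 hba ?_ ?_ ?_) (by simp) fun z hz => ?_
    · refine List.disjoint_append_left.2 ⟨fun z hz hz' => ?_, hxl' _ hd⟩
      exact hdisj _ _ le_rfl hz (hB _ _ _ (List.mem_reverse.1 hz')).2
    · exact List.disjoint_append_left.2 ⟨hdisj _ _ (by omega), hxl' _ (hdrop _)⟩
    · exact fun z hz hz' => hdisj _ _ le_rfl (hB _ _ _ (List.mem_reverse.1 hz)).1 hz'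
    · rw [← List.take_append_drop (j + 1) l, List.mem_append,
        ← List.take_append_drop (i + 1) (l.take (j + 1)), List.mem_append, List.take_take,
        min_eq_left (by omega)] at hz
      simp only [List.mem_append, List.mem_reverse]
      tauto
  set I := (Finset.range (l.length - 1)).filter fun i => G.Adj x (q i) ∧ G.Adj a (q i)
  have hI : ∀ i ∈ I, i + 1 < l.length ∧ G.Adj x (q i) ∧ G.Adj a (q i) := by
    intro i hi
    obtain ⟨h1, h2⟩ := Finset.mem_filter.1 hi
    rw [Finset.mem_range] at h1
    exact ⟨by omega, h2⟩
  have hcommon : (G.neighborFinset x ∩ G.neighborFinset a).card ≤ I.card + 1 := by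
    have hsub : G.neighborFinset x ∩ G.neighborFinset a ⊆ insert b (I.image q) := by
      intro u hu
      simp only [Finset.mem_inter, mem_neighborFinset] at hu
      obtain ⟨i, hi, hiu⟩ := List.mem_iff_getElem.1 (common_mem u hu.1 hu.2)
      have hqi : q i = u := by
        rw [hq, ← hiu]
        exact List.getD_eq_getElem _ _ hi
      rw [Finset.mem_insert, Finset.mem_image]
      rcases eq_or_ne i (l.length - 1) with rfl | hne
      · exact Or.inl (hqi.symm.trans hqb)
      · refine Or.inr ⟨i, Finset.mem_filter.2 ⟨Finset.mem_range.2 (by omega), ?_⟩, hqi⟩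
        rwa [hqi]
    calc _ ≤ _ := Finset.card_le_card hsub
      _ ≤ _ := Finset.card_insert_le _ _
      _ ≤ _ := Nat.add_le_add_right Finset.card_image_le 1
  have halpha : I.card ≤ G.alphaTwo x a := by
    have hcard : (I.image fun i => q (i + 1)).card = I.card := by
      refine Finset.card_image_of_injOn fun i hi j hj hij => ?_
      have hi := hI i hi
      have hj := hI j hj
      have := qinj _ _ hi.1 hj.1 hij
      omega
    rw [← hcard]
    refine card_le_alphaTwo ?_ ?_ ?_
    · intro z hz
      obtain ⟨i, hi, rfl⟩ := Finset.mem_image.1 hz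
      obtain ⟨h1, h2, h3⟩ := hI i hi
      exact dist_eq_two_of_common_neighbor (fun hc => hx (hc ▸ qmem _ h1)) (not_adj_succ i h1 h2)
        h2 (h.split a h1).2.2.1
    · intro z hz
      obtain ⟨i, hi, rfl⟩ := Finset.mem_image.1 hz
      obtain ⟨h1, h2, h3⟩ := hI i hi
      refine dist_eq_two_of_common_neighbor (fun hc => ?_) (head_not_adj_succ i h1 h2) h3
        (h.split a h1).2.2.1
      have := qinj 0 (i + 1) hpos h1 (hqa.trans hc)
      omega
    · intro u hu w hw huw
      obtain ⟨i, hi, rfl⟩ := Finset.mem_image.1 hu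
      obtain ⟨j, hj, rfl⟩ := Finset.mem_image.1 hw
      obtain ⟨h1, h2, -⟩ := hI i hi
      obtain ⟨h4, h5, -⟩ := hI j hj
      rcases lt_trichotomy i j with hij | rfl | hij
      · exact succ_not_adj_succ i j hij h4 h2 h5 huw
      · exact huw.ne rfl
      · exact succ_not_adj_succ j i hij h1 h5 h2 huw.symm
  have := hG x a (dist_eq_two_of_common_neighbor hxa not_adj_head hxb hba) (max_lt hxd ha)
  omega

/-- Some cycle passes through all vertices whose degree is at least the bipartite-hole-number. -/
lemma TwoConnected.exists_isCycleList_forall_mem (hG : G.TwoConnected) :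
    ∃ l, G.IsCycleList l ∧ ∀ v, G.bipartiteHoleNumber ≤ G.degree v → v ∈ l := by
  classical
  have hne : ((Finset.univ : Finset (Finset V)).filter fun A =>
      ∃ l, G.IsCycleList l ∧ l.toFinset = A).Nonempty := by
    have : Nontrivial V := Fintype.one_lt_card_iff_nontrivial.1 (by have := hG.1; omega)
    obtain ⟨x, y, hxy⟩ := exists_pair_ne V
    obtain ⟨z, -, hz⟩ := hG.exists_adj_ne hxy
    obtain ⟨l, hl, -⟩ := hG.exists_isCycleList_of_adj hz
    exact ⟨l.toFinset, by simpa using ⟨l, hl, rfl⟩⟩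
  obtain ⟨A, hA, hAmax⟩ := Finset.exists_max_image _
    (fun A => (A.filter fun v => G.bipartiteHoleNumber ≤ G.degree v).card) hne
  obtain ⟨-, l, hl, rfl⟩ := Finset.mem_filter.1 hA
  refine ⟨l, hl, fun x hx => ?_⟩
  by_contra hxl
  obtain ⟨a, b, hab, hba, -⟩ := id hl
  obtain ⟨y, w, r, h1, h2, h3, -, h5⟩ := hG.exists_path_to (C := {v | v ∈ l}) (v := a) hab.head_mem
    hxl ⟨b, hab.last_mem, hba.ne⟩
  obtain ⟨m, c, hm, hwc, -⟩ := hl.exists_rotate_head h3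
  obtain ⟨d, p, p1, p2, p3⟩ := (h1.append hwc h5 fun z hz hz' => h2 z hz ((hm z).1 hz')).exists_trim
    (fun v => G.bipartiteHoleNumber ≤ G.degree v) hx
  obtain ⟨l', hl', hpl'⟩ := hG.exists_isCycleList_of_le_degree p1 hx p2
  have hle := hAmax l'.toFinset (by simpa using ⟨l', hl', rfl⟩)
  refine hle.not_gt (Finset.card_lt_card (Finset.ssubset_iff_of_subset ?_ |>.2 ⟨x, ?_, ?_⟩))
  · intro z hz
    simp only [Finset.mem_filter, List.mem_toFinset] at hz ⊢
    exact ⟨hpl' (p3 z (List.mem_append_right _ ((hm z).2 hz.1)) hz.2), hz.2⟩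
  · simpa using ⟨hpl' p1.head_mem, hx⟩
  · simp [hxl]

lemma TwoConnected.exists_maximal_isCycleList (hG : G.TwoConnected) :
    ∃ l, G.IsCycleList l ∧ (∀ v, G.bipartiteHoleNumber ≤ G.degree v → v ∈ l) ∧
      ∀ l', G.IsCycleList l' → l ⊆ l' → l' ⊆ l := by
  classical
  obtain ⟨l₀, h₀, hl₀⟩ := hG.exists_isCycleList_forall_mem
  obtain ⟨A, hA, hAmax⟩ := Finset.exists_max_image ((Finset.univ : Finset (Finset V)).filter fun A =>
      ∃ l, G.IsCycleList l ∧ l₀ ⊆ l ∧ l.toFinset = A) Finset.card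
      ⟨l₀.toFinset, by simpa using ⟨l₀, h₀, List.Subset.refl _, rfl⟩⟩
  obtain ⟨-, l, hl, hsub, rfl⟩ := Finset.mem_filter.1 hA
  refine ⟨l, hl, fun v hv => hsub (hl₀ v hv), fun l' hl' hll' z hz => ?_⟩
  have hle := hAmax l'.toFinset (by simpa using ⟨l', hl', List.Subset.trans hsub hll', rfl⟩)
  have hss : l.toFinset ⊆ l'.toFinset := fun z hz => by
    simp only [List.mem_toFinset] at hz ⊢
    exact hll' hz
  rw [← List.mem_toFinset, Finset.eq_of_subset_of_card_le hss hle]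
  simpa using hz

end SimpleGraph

theorem hamiltonian_of_common_neighbors {V : Type*} [Fintype V] [DecidableEq V]
    (G : SimpleGraph V) [DecidableRel G.Adj] (hG : G.TwoConnected)
    (h : ∀ x y : V, G.dist x y = 2 →
      max (G.degree x) (G.degree y) < G.bipartiteHoleNumber →
      G.alphaTwo x y + 2 ≤ (G.neighborFinset x ∩ G.neighborFinset y).card) :
    G.IsHamiltonian := by
  obtain ⟨l, hl, hlarge, hmax⟩ := hG.exists_maximal_isCycleList
  refine hl.isHamiltonian fun x₀ => ?_
  by_contra hx₀
  obtain ⟨a, b, hab, hba, -⟩ := id hl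
  obtain ⟨x₁, v₁, r₁, p1, p2, p3, -, p5⟩ := hG.exists_path_to (C := {v | v ∈ l}) (v := a)
    hab.head_mem hx₀ ⟨b, hab.last_mem, hba.ne⟩
  have hx₁ : x₁ ∉ l := p2 x₁ p1.last_mem
  obtain ⟨x₂, v₂, r, q1, q2, q3, q4, q5⟩ := hG.exists_path_to (C := {v | v ∈ l}) (v := v₁) p3 hx₁
    (by
      by_cases h1 : a = v₁
      · exact ⟨b, hab.last_mem, h1 ▸ hba.ne⟩
      · exact ⟨a, hab.head_mem, h1⟩)
  have hx₂ : x₂ ∉ l := q2 x₂ q1.last_mem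
  -- Cut the cycle just after `v₁` and just after `v₂`.
  obtain ⟨E₁, E₂, c₁, c₂, h1, h2, hd, h12, h21, hmem⟩ : ∃ E₁ E₂ c₁ c₂,
      G.IsPathList c₁ v₂ E₁ ∧ G.IsPathList c₂ v₁ E₂ ∧ E₁.Disjoint E₂ ∧ G.Adj v₂ c₂ ∧
      G.Adj v₁ c₁ ∧ ∀ z, z ∈ l ↔ z ∈ E₁ ∨ z ∈ E₂ := by
    obtain ⟨l₁, l₂, rfl⟩ := List.append_of_mem p3
    have hrot := hl
    rw [← List.singleton_append, ← List.append_assoc] at hrot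
    obtain ⟨c, d, h1, h2, -⟩ := hrot.rotate
    have hd : v₁ = d := by simpa [List.getLast?_append] using h1.2.2.2
    subst hd
    have hv₂ : v₂ ∈ l₂ ++ l₁ := by
      have : v₂ ∈ l₁ ++ v₁ :: l₂ := q3
      simp only [List.mem_append, List.mem_cons] at this ⊢
      tauto
    obtain ⟨m₁, m₂, hm⟩ := List.append_of_mem hv₂
    have hsplit : l₂ ++ (l₁ ++ [v₁]) = (m₁ ++ [v₂]) ++ (m₂ ++ [v₁]) := by
      rw [← List.append_assoc, hm]
      simp
    rw [hsplit] at h1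
    obtain ⟨e, f, k1, k2, k3, k4⟩ := h1.of_append (by simp) (by simp)
    have he : v₂ = e := by simpa using k1.2.2.2
    subst he
    refine ⟨_, _, c, f, k1, k2, k4, k3, h2, fun z => ?_⟩
    rw [← List.mem_append, ← hsplit]
    simp only [List.mem_append, List.mem_cons, List.not_mem_nil, or_false]
    tauto
  have hlE : ∀ {m : List V}, (∀ z, z ∈ m ↔ z ∈ l) → (∀ l', G.IsCycleList l' → m ⊆ l' → l' ⊆ m) ∧
      ∀ v, G.bipartiteHoleNumber ≤ G.degree v → v ∈ m := fun hm =>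
    ⟨fun l' hl' hml' z hz => (hm z).2 (hmax l' hl' (fun y hy => hml' ((hm y).2 hy)) hz),
      fun v hv => (hm v).2 (hlarge v hv)⟩
  have m12 : ∀ z, z ∈ E₁ ++ E₂ ↔ z ∈ l := fun z => by rw [List.mem_append, hmem]
  have m21 : ∀ z, z ∈ E₂ ++ E₁ ↔ z ∈ l := fun z => by rw [List.mem_append, hmem, or_comm]
  have hc₁ := (h1.append h2 h12 hd).le_degree_of_adj_last h h21 (hlE m12).1 (hlE m12).2
    (by rwa [m12]) p5
  have hc₂ := (h2.append h1 h21 hd.symm).le_degree_of_adj_last h h12 (hlE m21).1 (hlE m21).2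
    (by rwa [m21]) q5
  have hpath := (h1.append q1.reverse q5.symm (fun z hz hz' =>
    q2 z (List.mem_reverse.1 hz') ((hmem z).2 (Or.inl hz)))).append h2.reverse p5 (fun z hz hz' => by
      rcases List.mem_append.1 hz with hz | hz
      · exact hd hz (List.mem_reverse.1 hz')
      · exact q2 z (List.mem_reverse.1 hz) ((hmem z).2 (Or.inr (List.mem_reverse.1 hz'))))
  obtain ⟨l', hl', hsub⟩ := hG.exists_isCycleList_of_le_degree hpath hc₁ hc₂
  refine hx₁ (hmax l' hl' (fun z hz => hsub ?_) (hsub ?_))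
  · simp only [List.mem_append, List.mem_reverse]
    exact ((hmem z).1 hz).imp Or.inl id
  · simp [q1.head_mem]
end

section
/- Let G be a finite simple graph of order at least three. If the minimum degree of G satisfies δ(G) ≥ α̃(G), where α̃(G) is the bipartite-hole-number of G, then G is hamiltonian. -/
namespace SimpleGraph

variable {V : Type*} (G : SimpleGraph V)

/-- A bipartite hole contains all smaller bipartite holes. -/
lemma HasBipartiteHole.of_card_le {G : SimpleGraph V} {s t : ℕ} {S T : Finset V}
    (hST : Disjoint S T) (hs : s ≤ S.card) (ht : t ≤ T.card)
    (h : ∀ a ∈ S, ∀ b ∈ T, ¬ G.Adj a b) : G.HasBipartiteHole s t := by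
  obtain ⟨S', hS', rfl⟩ := Finset.exists_subset_card_eq hs
  obtain ⟨T', hT', rfl⟩ := Finset.exists_subset_card_eq ht
  exact ⟨S', T', Finset.disjoint_of_subset_left hS' (Finset.disjoint_of_subset_right hT' hST),
    rfl, rfl, fun a ha b hb => h a (hS' ha) b (hT' hb)⟩

/-- The bipartite-hole-number of a finite graph is attained. -/
lemma exists_bipartiteHoleNumber_eq [Fintype V] :
    ∃ s t : ℕ, 0 < s ∧ 0 < t ∧ s + t = G.bipartiteHoleNumber + 1 ∧ ¬ G.HasBipartiteHole s t := by
  refine Nat.sInf_mem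
    (s := {k : ℕ | ∃ s t : ℕ, 0 < s ∧ 0 < t ∧ s + t = k + 1 ∧ ¬ G.HasBipartiteHole s t}) ?_
  refine ⟨Fintype.card V + 1, Fintype.card V + 1, 1, by omega, by omega, rfl, ?_⟩
  rintro ⟨S, T, -, hS, -, -⟩
  have := S.card_le_univ
  omega

section Gaps

variable [DecidableRel G.Adj]

/-- `0` if the two vertices are adjacent and `1` otherwise. -/
def gap (a b : V) : ℕ := if G.Adj a b then 0 else 1

/-- The number of consecutive pairs of nonadjacent vertices in a list. -/
def gaps : List V → ℕ
  | [] => 0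
  | [_] => 0
  | a :: b :: l => G.gap a b + gaps (b :: l)

variable {G}

lemma gap_comm (a b : V) : G.gap a b = G.gap b a := by
  simp [gap, G.adj_comm]

lemma gap_eq_zero {a b : V} : G.gap a b = 0 ↔ G.Adj a b := by
  simp [gap]

lemma gap_eq_one {a b : V} : G.gap a b = 1 ↔ ¬ G.Adj a b := by
  simp [gap]

lemma gaps_append : ∀ {A B : List V} (hA : A ≠ []) (hB : B ≠ []),
    G.gaps (A ++ B) = G.gaps A + G.gap (A.getLast hA) (B.head hB) + G.gaps B
  | [a], b :: B, _, _ => by simp [gaps]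
  | a :: a' :: A, b :: B, _, hB => by
    have := gaps_append (A := a' :: A) (by simp) hB
    simp only [List.cons_append, gaps, List.getLast_cons_cons] at this ⊢
    omega

lemma gaps_reverse : ∀ l : List V, G.gaps l.reverse = G.gaps l
  | [] => rfl
  | [_] => rfl
  | a :: b :: l => by
    have := gaps_reverse (b :: l)
    rw [List.reverse_cons, gaps_append (by simp) (by simp), this, List.getLast_reverse]
    simp [gaps, gap_comm b a, add_comm]

lemma exists_split_of_not_isChain : ∀ {l : List V}, ¬ l.IsChain G.Adj →
    ∃ (A B : List V) (hA : A ≠ []) (hB : B ≠ []), l = A ++ B ∧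
      ¬ G.Adj (A.getLast hA) (B.head hB)
  | [], h => by simp at h
  | [_], h => by simp at h
  | a :: b :: l, h => by
    by_cases hab : G.Adj a b
    · obtain ⟨A, B, hA, hB, hl, hAB⟩ :=
        exists_split_of_not_isChain (l := b :: l) (fun h' => h (by simp [hab, h']))
      exact ⟨a :: A, B, by simp, hB, by simp [hl], by rwa [List.getLast_cons hA]⟩
    · exact ⟨[a], b :: l, by simp, by simp, rfl, by simpa using hab⟩

variable (G) in
/-- The number of pairs of nonadjacent vertices that are consecutive in the cyclic order given
by a list. -/
def cyclicGaps (l : List V) : ℕ :=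
  if h : l = [] then 0 else G.gaps l + G.gap (l.getLast h) (l.head h)

lemma cyclicGaps_of_ne_nil {l : List V} (h : l ≠ []) :
    G.cyclicGaps l = G.gaps l + G.gap (l.getLast h) (l.head h) := dif_neg h

lemma cyclicGaps_append_comm {A B : List V} (hA : A ≠ []) (hB : B ≠ []) :
    G.cyclicGaps (B ++ A) = G.cyclicGaps (A ++ B) := by
  rw [cyclicGaps_of_ne_nil (by simp [hA]), cyclicGaps_of_ne_nil (by simp [hA]),
    gaps_append hA hB, gaps_append hB hA]
  simp only [List.getLast_append_of_ne_nil _ hA, List.getLast_append_of_ne_nil _ hB,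
    List.head_append_of_ne_nil hA, List.head_append_of_ne_nil hB]
  omega

lemma cyclicGaps_append_reverse_lt {A B C : List V} (hA : A ≠ []) (hB : B ≠ []) (hC : C ≠ [])
    (hCA : ¬ G.Adj (C.getLast hC) (A.head hA)) (hAB : G.Adj (A.head hA) (B.head hB))
    (hBC : G.Adj (B.getLast hB) (C.getLast hC)) (hAC : G.Adj (A.getLast hA) (C.head hC)) :
    G.cyclicGaps (A ++ (C ++ B.reverse)) < G.cyclicGaps (A ++ (B ++ C)) := by
  have hB' : B.reverse ≠ [] := by simpa
  have hCB : C ++ B.reverse ≠ [] := by simp [hC]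
  have hBC' : B ++ C ≠ [] := by simp [hC]
  rw [cyclicGaps_of_ne_nil (by simp [hA]), cyclicGaps_of_ne_nil (by simp [hA]),
    gaps_append hA hCB, gaps_append hA hBC', gaps_append hC hB', gaps_append hB hC, gaps_reverse]
  simp only [List.getLast_append_of_ne_nil _ hCB, List.getLast_append_of_ne_nil _ hBC',
    List.getLast_append_of_ne_nil _ hB', List.getLast_append_of_ne_nil _ hC,
    List.head_append_of_ne_nil hA, List.head_append_of_ne_nil hB, List.head_append_of_ne_nil hC,
    List.head_reverse, List.getLast_reverse]
  rw [gap_eq_one.2 hCA, gap_eq_zero.2 hAC, gap_eq_zero.2 hAB.symm, gap_eq_zero.2 hBC.symm]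
  omega

lemma cyclicGaps_append_swap_lt {A B C : List V} (hA : A ≠ []) (hB : B ≠ []) (hC : C ≠ [])
    (hCA : ¬ G.Adj (C.getLast hC) (A.head hA)) (hAB : G.Adj (A.head hA) (B.getLast hB))
    (hAC : G.Adj (A.getLast hA) (C.getLast hC)) (hBC : G.Adj (B.head hB) (C.head hC)) :
    G.cyclicGaps (B ++ (A ++ C.reverse)) < G.cyclicGaps (A ++ (B ++ C)) := by
  have hC' : C.reverse ≠ [] := by simpa
  have hAC' : A ++ C.reverse ≠ [] := by simp [hC]
  have hBC' : B ++ C ≠ [] := by simp [hC]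
  rw [cyclicGaps_of_ne_nil (by simp [hB]), cyclicGaps_of_ne_nil (by simp [hA]),
    gaps_append hB hAC', gaps_append hA hBC', gaps_append hA hC', gaps_append hB hC, gaps_reverse]
  simp only [List.getLast_append_of_ne_nil _ hAC', List.getLast_append_of_ne_nil _ hBC',
    List.getLast_append_of_ne_nil _ hC', List.getLast_append_of_ne_nil _ hC,
    List.head_append_of_ne_nil hA, List.head_append_of_ne_nil hB,
    List.head_reverse, List.getLast_reverse]
  rw [gap_eq_one.2 hCA, gap_eq_zero.2 hAB.symm, gap_eq_zero.2 hAC, gap_eq_zero.2 hBC.symm]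
  omega

end Gaps

/-- A Hamiltonian cycle from a cyclic ordering of the vertices with consecutive vertices
adjacent. -/
lemma IsHamiltonian.of_isChain [Fintype V] [DecidableEq V] {G : SimpleGraph V} {l : List V}
    (hl : l.Nodup) (hmem : ∀ v, v ∈ l) (hcard : 3 ≤ Fintype.card V) (hne : l ≠ [])
    (hchain : l.IsChain G.Adj) (hadj : G.Adj (l.getLast hne) (l.head hne)) :
    G.IsHamiltonian := by
  intro _
  have hlen : l.length = Fintype.card V := by
    rw [← List.toFinset_card_of_nodup hl, ← Finset.card_univ]
    congr 1
    ext v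
    simp [hmem]
  let p := Walk.ofSupport l hne hchain
  have hp : p.IsPath := by
    rw [Walk.isPath_def, Walk.support_ofSupport]
    exact hl
  have hplen : p.length = l.length - 1 := Walk.length_ofSupport hne hchain
  refine ⟨_, p.cons hadj, Walk.isHamiltonianCycle_iff_isCycle_and_length_eq.2 ⟨?_, ?_⟩⟩
  · rw [Walk.isCycle_iff_isPath_tail_and_le_length]
    refine ⟨by simpa using hp, ?_⟩
    rw [Walk.length_cons]
    omega
  · rw [Walk.length_cons]
    omega

section Crossing

variable [Fintype V] [DecidableRel G.Adj]

variable {G} in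
/-- In an enumeration `p` of the vertices with `x` a vertex, the number of indices of neighbours
of `x` is the degree of `x`. -/
lemma card_filter_adj_range {p : ℕ → V} {n : ℕ} (hinj : Set.InjOn p (Finset.range n))
    (hsurj : ∀ v, ∃ i < n, p i = v) (x : V) :
    ((Finset.range n).filter fun i => G.Adj x (p i)).card = G.degree x := by
  classical
  rw [← card_neighborFinset_eq_degree, ← Finset.card_image_of_injOn
    (hinj.mono (Finset.coe_subset.2 (Finset.filter_subset _ _)))]
  congr 1
  ext v
  simp only [Finset.mem_image, Finset.mem_filter, Finset.mem_range, mem_neighborFinset]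
  constructor
  · rintro ⟨i, ⟨-, h⟩, rfl⟩
    exact h
  · intro h
    obtain ⟨i, hi, rfl⟩ := hsurj v
    exact ⟨i, ⟨hi, h⟩, rfl⟩

variable {G} in
/-- In an enumeration of the vertices with nonadjacent ends, one of the two crossing
configurations occurs. -/
lemma exists_crossing {s t : ℕ} (hs : 0 < s) (ht : 0 < t) (hhole : ¬ G.HasBipartiteHole s t)
    (hdeg : s + t ≤ G.minDegree + 1) {p : ℕ → V} {n : ℕ}
    (hinj : Set.InjOn p (Finset.range (n + 1))) (hsurj : ∀ v, ∃ i < n + 1, p i = v)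
    (hends : ¬ G.Adj (p 0) (p n)) :
    (∃ i j, 0 < i ∧ i ≤ j ∧ j < n ∧
      G.Adj (p 0) (p i) ∧ G.Adj (p n) (p j) ∧ G.Adj (p (i - 1)) (p (j + 1))) ∨
    (∃ i j, j < i ∧ i < n ∧
      G.Adj (p 0) (p i) ∧ G.Adj (p n) (p j) ∧ G.Adj (p (j + 1)) (p (i + 1))) := by
  classical
  set M := (Finset.range (n + 1)).filter fun i => G.Adj (p 0) (p i)
  set N := (Finset.range (n + 1)).filter fun i => G.Adj (p n) (p i)
  have hMcard : s + t ≤ M.card + 1 := by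
    have : G.minDegree ≤ M.card :=
      (G.minDegree_le_degree (p 0)).trans (card_filter_adj_range hinj hsurj (p 0)).ge
    omega
  have hNcard : s + t ≤ N.card + 1 := by
    have : G.minDegree ≤ N.card :=
      (G.minDegree_le_degree (p n)).trans (card_filter_adj_range hinj hsurj (p n)).ge
    omega
  have hMmem : ∀ i ∈ M, 0 < i ∧ i < n ∧ G.Adj (p 0) (p i) := by
    intro i hi
    obtain ⟨hi, hadj⟩ := Finset.mem_filter.1 hi
    have h0 : i ≠ 0 := by rintro rfl; exact G.loopless.irrefl _ hadj
    have hn : i ≠ n := by rintro rfl; exact hends hadj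
    have := Finset.mem_range.1 hi
    exact ⟨by omega, by omega, hadj⟩
  have hNmem : ∀ i ∈ N, i < n ∧ G.Adj (p n) (p i) := by
    intro i hi
    obtain ⟨hi, hadj⟩ := Finset.mem_filter.1 hi
    have hn : i ≠ n := by rintro rfl; exact G.loopless.irrefl _ hadj
    have := Finset.mem_range.1 hi
    exact ⟨by omega, hadj⟩
  have hole : ∀ (I J : Finset ℕ) (f g : ℕ → ℕ), s ≤ I.card → t ≤ J.card →
      Set.InjOn f I → Set.InjOn g J → (∀ i ∈ I, ∀ j ∈ J, f i < g j) →
      (∀ i ∈ I, f i < n + 1) → (∀ j ∈ J, g j < n + 1) →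
      ∃ i ∈ I, ∃ j ∈ J, G.Adj (p (f i)) (p (g j)) := by
    intro I J f g hI hJ hf hg hfg hfn hgn
    by_contra! hno
    refine hhole (HasBipartiteHole.of_card_le (S := I.image (p ∘ f)) (T := J.image (p ∘ g))
      ?_ ?_ ?_ ?_)
    · simp only [Finset.disjoint_left, Finset.mem_image, Function.comp]
      rintro _ ⟨i, hi, rfl⟩ ⟨j, hj, hij⟩
      have := hinj (by simpa using hgn j hj) (by simpa using hfn i hi) hij
      have := hfg i hi j hj
      omega
    · rwa [Finset.card_image_of_injOn (hinj.comp hf fun i hi => by simpa using hfn i hi)]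
    · rwa [Finset.card_image_of_injOn (hinj.comp hg fun i hi => by simpa using hgn i hi)]
    · simp only [Finset.mem_image, Function.comp]
      rintro _ ⟨i, hi, rfl⟩ _ ⟨j, hj, rfl⟩
      exact hno i hi j hj
  have hex : ∃ a, s ≤ (M.filter (· ≤ a)).card := by
    refine ⟨n, ?_⟩
    rw [Finset.filter_true_of_mem fun i hi => (hMmem i hi).2.1.le]
    omega
  obtain ⟨a, ha, hmin⟩ : ∃ a, s ≤ (M.filter (· ≤ a)).card ∧ (M.filter (· < a)).card < s := by
    refine ⟨Nat.find hex, Nat.find_spec hex, ?_⟩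
    rcases h : Nat.find hex with _ | b
    · simpa using hs
    · have := Nat.find_min hex (m := b) (by omega)
      simpa [Nat.lt_succ_iff] using this
  have hMsplit := Finset.card_filter_add_card_filter_not (s := M) (· < a)
  have hNsplit := Finset.card_filter_add_card_filter_not (s := N) (· < a)
  simp only [not_lt] at hMsplit hNsplit
  by_cases hNa : t ≤ (N.filter (a ≤ ·)).card
  · left
    obtain ⟨i, hi, j, hj, hij⟩ := hole (M.filter (· ≤ a)) (N.filter (a ≤ ·)) (· - 1) (· + 1)
      ha hNa
      (by simp only [Set.InjOn, Finset.mem_coe]; grind)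
      (by simp only [Set.InjOn, Finset.mem_coe]; grind)
      (by grind) (by grind) (by grind)
    obtain ⟨hi, hia⟩ := Finset.mem_filter.1 hi
    obtain ⟨hj, hja⟩ := Finset.mem_filter.1 hj
    exact ⟨i, j, (hMmem i hi).1, hia.trans hja, (hNmem j hj).1, (hMmem i hi).2.2,
      (hNmem j hj).2, hij⟩
  · right
    obtain ⟨j, hj, i, hi, hij⟩ := hole (N.filter (· < a)) (M.filter (a ≤ ·)) (· + 1) (· + 1)
      (by omega) (by omega)
      (by simp only [Set.InjOn, Finset.mem_coe]; grind)
      (by simp only [Set.InjOn, Finset.mem_coe]; grind)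
      (by grind) (by grind) (by grind)
    obtain ⟨hi, hia⟩ := Finset.mem_filter.1 hi
    obtain ⟨hj, hja⟩ := Finset.mem_filter.1 hj
    exact ⟨i, j, hja.trans_le hia, (hMmem i hi).2.1, (hMmem i hi).2.2, (hNmem j hj).2, hij⟩

variable {G} in
/-- A list enumerating the vertices whose ends are nonadjacent can be rearranged so as to have
fewer cyclic gaps. -/
lemma exists_perm_cyclicGaps_lt {s t : ℕ} (hs : 0 < s) (ht : 0 < t)
    (hhole : ¬ G.HasBipartiteHole s t) (hdeg : s + t ≤ G.minDegree + 1) {l : List V}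
    (hl : l.Nodup) (hmem : ∀ v, v ∈ l) (hne : l ≠ [])
    (hends : ¬ G.Adj (l.getLast hne) (l.head hne)) :
    ∃ l' : List V, l'.Perm l ∧ G.cyclicGaps l' < G.cyclicGaps l := by
  obtain ⟨n, hn⟩ : ∃ n, l.length = n + 1 :=
    Nat.exists_eq_succ_of_ne_zero (by simpa using hne)
  let p : ℕ → V := fun i => l.getD i (l.head hne)
  have hp : ∀ i (hi : i < l.length), p i = l[i] := fun i hi => List.getD_eq_getElem _ _ hi
  have hp0 : p 0 = l.head hne := by rw [hp 0 (by omega), List.head_eq_getElem]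
  have hpn : p n = l.getLast hne := by
    rw [hp n (by omega), List.getLast_eq_getElem]
    simp [hn]
  have hinj : Set.InjOn p (Finset.range (n + 1)) := by
    intro i hi j hj hij
    simp only [Finset.coe_range, Set.mem_Iio] at hi hj
    rw [hp i (by omega), hp j (by omega)] at hij
    exact (hl.getElem_inj_iff).1 hij
  have hsurj : ∀ v, ∃ i < n + 1, p i = v := by
    intro v
    obtain ⟨i, hi, rfl⟩ := List.getElem_of_mem (hmem v)
    exact ⟨i, by omega, hp i hi⟩
  have split : ∀ i j, 0 < i → i < j → j < n + 1 → ∃ (A B C : List V) (hA : A ≠ []) (hB : B ≠ [])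
      (hC : C ≠ []), l = A ++ (B ++ C) ∧ A.head hA = p 0 ∧ A.getLast hA = p (i - 1) ∧
        B.head hB = p i ∧ B.getLast hB = p (j - 1) ∧ C.head hC = p j ∧ C.getLast hC = p n := by
    intro i j hi hij hj
    refine ⟨l.take i, (l.drop i).take (j - i), l.drop j, ?_, ?_, ?_, ?_, ?_, ?_, ?_, ?_, ?_, ?_⟩
    · simp [hne]; omega
    · simp; omega
    · simp; omega
    · have : l.drop j = (l.drop i).drop (j - i) := by
        rw [List.drop_drop]; congr 1; omega
      rw [this, List.take_append_drop, List.take_append_drop]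
    · rw [List.head_take, hp0]
    · rw [List.getLast_eq_getElem, hp _ (by omega), List.getElem_take]
      congr 1
      simp; omega
    · rw [List.head_take, List.head_drop, hp]
    · rw [List.getLast_eq_getElem, hp _ (by omega), List.getElem_take, List.getElem_drop]
      congr 1
      simp; omega
    · rw [List.head_drop, hp]
    · rw [List.getLast_drop, hpn]
  rw [← hp0, ← hpn, G.adj_comm] at hends
  rcases exists_crossing hs ht hhole hdeg hinj hsurj hends with
    ⟨i, j, hi, hij, hj, h₁, h₂, h₃⟩ | ⟨i, j, hji, hi, h₁, h₂, h₃⟩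
  · obtain ⟨A, B, C, hA, hB, hC, rfl, hAh, hAl, hBh, hBl, hCh, hCl⟩ :=
      split i (j + 1) hi (by omega) (by omega)
    rw [Nat.add_sub_cancel] at hBl
    refine ⟨A ++ (C ++ B.reverse), ?_, cyclicGaps_append_reverse_lt hA hB hC ?_ ?_ ?_ ?_⟩
    · exact ((((List.reverse_perm B).append_left C).trans List.perm_append_comm).append_left A)
    · rwa [hCl, hAh, G.adj_comm]
    · rwa [hAh, hBh]
    · rw [hBl, hCl]; exact h₂.symm
    · rwa [hAl, hCh]
  · obtain ⟨A, B, C, hA, hB, hC, rfl, hAh, hAl, hBh, hBl, hCh, hCl⟩ :=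
      split (j + 1) (i + 1) (by omega) (by omega) (by omega)
    rw [Nat.add_sub_cancel] at hAl hBl
    refine ⟨B ++ (A ++ C.reverse), ?_, cyclicGaps_append_swap_lt hA hB hC ?_ ?_ ?_ ?_⟩
    · rw [← List.append_assoc, ← List.append_assoc]
      exact List.perm_append_comm.append (List.reverse_perm C)
    · rwa [hCl, hAh, G.adj_comm]
    · rwa [hAh, hBl]
    · rw [hAl, hCl]; exact h₂.symm
    · rwa [hBh, hCh]

end Crossing

end SimpleGraph

theorem hamiltonian_of_minDegree_ge_bipartiteHoleNumber {V : Type*} [Fintype V] [DecidableEq V]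
    (G : SimpleGraph V) [DecidableRel G.Adj] (hn : 3 ≤ Fintype.card V)
    (hδ : G.bipartiteHoleNumber ≤ G.minDegree) :
    G.IsHamiltonian := by
  obtain ⟨s, t, hs, ht, hst, hhole⟩ := G.exists_bipartiteHoleNumber_eq
  suffices H : ∀ (m : ℕ) (l : List V), G.cyclicGaps l = m → l.Nodup → (∀ v, v ∈ l) →
      G.IsHamiltonian from
    H _ Finset.univ.toList rfl (Finset.nodup_toList _) (by simp)
  intro m
  induction m using Nat.strong_induction_on with
  | _ m ih =>
    rintro l rfl hl hmem
    have hne : l ≠ [] := by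
      obtain ⟨v⟩ : Nonempty V := Fintype.card_pos_iff.1 (by omega)
      exact List.ne_nil_of_mem (hmem v)
    have improve : ∀ l₁ : List V, l₁.Perm l → G.cyclicGaps l₁ = G.cyclicGaps l →
        ∀ hne₁ : l₁ ≠ [], ¬ G.Adj (l₁.getLast hne₁) (l₁.head hne₁) → G.IsHamiltonian := by
      intro l₁ hperm hgaps hne₁ hends
      obtain ⟨l₂, hperm₂, hlt⟩ := SimpleGraph.exists_perm_cyclicGaps_lt hs ht hhole (by omega)
        (hperm.nodup_iff.2 hl) (fun v => hperm.mem_iff.2 (hmem v)) hne₁ hends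
      have hperm' := hperm₂.trans hperm
      exact ih _ (hgaps ▸ hlt) l₂ rfl (hperm'.nodup_iff.2 hl) fun v => hperm'.mem_iff.2 (hmem v)
    by_cases hends : G.Adj (l.getLast hne) (l.head hne)
    · by_cases hchain : l.IsChain G.Adj
      · exact .of_isChain hl hmem hn hne hchain hends
      · obtain ⟨A, B, hA, hB, rfl, hAB⟩ := SimpleGraph.exists_split_of_not_isChain hchain
        refine improve (B ++ A) List.perm_append_comm (SimpleGraph.cyclicGaps_append_comm hA hB)
          (by simp [hA]) ?_
        rwa [List.getLast_append_of_ne_nil _ hA, List.head_append_of_ne_nil hB]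
    · exact improve l (.refl l) rfl hne hends
end

section
/- Let G be a finite simple graph of order at least three. If the minimum degree of G satisfies δ(G) ≥ α̃(G) + 1, where α̃(G) is the bipartite-hole-number of G, then G is hamiltonian-connected. -/
open Finset in
/-- Two sets of positions admit either a non-crossing or a crossing pair of large subsets avoiding
a prescribed position. -/
lemma exists_noncrossing_or_crossing_subsets {A B : Finset ℕ} {s t m : ℕ} (hs : 0 < s) (ht : 0 < t)
    (hA : s + t ≤ #A) (hB : s + t ≤ #B) :
    (∃ A' ⊆ A, ∃ B' ⊆ B, #A' = s ∧ #B' = t ∧ m + 1 ∉ A' ∧ m ∉ B' ∧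
      ∀ i ∈ A', ∀ j ∈ B', i ≤ j) ∨
    ∃ A' ⊆ A, ∃ B' ⊆ B, #A' = t ∧ #B' = s ∧ m ∉ A' ∧ m ∉ B' ∧ ∀ i ∈ A', ∀ j ∈ B', j < i := by
  classical
  have hex : ∃ p, s ≤ #{i ∈ A.erase (m + 1) | i ≤ p} := by
    refine ⟨A.sup id, ?_⟩
    rw [filter_true_of_mem fun i hi => show i ≤ A.sup id from
      le_sup (f := id) (mem_of_mem_erase hi)]
    have := pred_card_le_card_erase (s := A) (a := m + 1)
    omega
  obtain ⟨p, hp, hmin⟩ : ∃ p, s ≤ #{i ∈ A.erase (m + 1) | i ≤ p} ∧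
      #{i ∈ A.erase (m + 1) | i < p} < s := by
    refine ⟨Nat.find hex, Nat.find_spec hex, ?_⟩
    rcases h : Nat.find hex with _ | q
    · simpa using hs
    · have := Nat.find_min hex (m := q) (by omega)
      simpa [Nat.lt_succ_iff] using this
  have hBsplit := card_filter_add_card_filter_not (s := B.erase m) (· < p)
  have hBerase := pred_card_le_card_erase (s := B) (a := m)
  by_cases hBt : t ≤ #{j ∈ B.erase m | ¬ j < p}
  · left
    obtain ⟨A', hA', rfl⟩ := exists_subset_card_eq hp
    obtain ⟨B', hB', rfl⟩ := exists_subset_card_eq hBt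
    refine ⟨A', fun i hi => ?_, B', fun i hi => ?_, rfl, rfl, fun hi => ?_, fun hi => ?_,
      fun i hi j hj => ?_⟩
    · have := hA' hi; simp_all
    · have := hB' hi; simp_all
    · have := hA' hi; simp at this
    · have := hB' hi; simp at this
    · have h1 := hA' hi
      have h2 := hB' hj
      simp only [mem_filter] at h1 h2
      omega
  · right
    have hBs : s ≤ #{j ∈ B.erase m | j < p} := by omega
    have hAt : t ≤ #{i ∈ A.erase m | ¬ i < p} := by
      have hAsplit := card_filter_add_card_filter_not (s := A) (· < p)
      have e1 : #{i ∈ A.erase (m + 1) | i < p} = #({i ∈ A | i < p}.erase (m + 1)) := by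
        rw [filter_erase]
      have e2 : #{i ∈ A.erase m | ¬ i < p} = #({i ∈ A | ¬ i < p}.erase m) := by
        rw [filter_erase]
      rw [e1, card_erase_eq_ite] at hmin
      rw [e2, card_erase_eq_ite]
      simp only [mem_filter] at hmin ⊢
      split_ifs at hmin ⊢ <;> omega
    obtain ⟨A', hA', rfl⟩ := exists_subset_card_eq hAt
    obtain ⟨B', hB', rfl⟩ := exists_subset_card_eq hBs
    refine ⟨A', fun i hi => ?_, B', fun i hi => ?_, rfl, rfl, fun hi => ?_, fun hi => ?_,
      fun i hi j hj => ?_⟩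
    · have := hA' hi; simp_all
    · have := hB' hi; simp_all
    · have := hA' hi; simp at this
    · have := hB' hi; simp at this
    · have h1 := hA' hi
      have h2 := hB' hj
      simp only [mem_filter] at h1 h2
      omega

namespace List

variable {α : Type*} {R : α → α → Prop} {P Q T : List α} {p₁ q₀ q₁ t₀ : α}

lemma isChain_reverse_iff_of_symm (hR : ∀ a b, R a b → R b a) :
    P.reverse.IsChain R ↔ P.IsChain R :=
  isChain_reverse.trans (IsChain.iff fun a b => ⟨hR b a, hR a b⟩)

lemma isChain_append_append_iff (hp₁ : P.getLast? = some p₁) (hq₀ : Q.head? = some q₀)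
    (hq₁ : Q.getLast? = some q₁) (ht₀ : T.head? = some t₀) :
    (P ++ Q ++ T).IsChain R ↔
      P.IsChain R ∧ Q.IsChain R ∧ T.IsChain R ∧ R p₁ q₀ ∧ R q₁ t₀ := by
  simp [isChain_append, hp₁, hq₀, hq₁, ht₀]
  tauto

lemma isChain_split_of_nodup {V : Type*} {G : SimpleGraph V} {x y : V} {l : List V}
    (hl : l.Nodup) (hc : l.IsChain (G ⊔ SimpleGraph.edge x y).Adj)
    (hxy : ¬ l.IsChain fun a b => s(a, b) ≠ s(x, y)) :
    ∃ l₁ a b l₂, l = l₁ ++ a :: b :: l₂ ∧ s(a, b) = s(x, y) ∧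
      (l₁ ++ [a]).IsChain G.Adj ∧ (b :: l₂).IsChain G.Adj := by
  rw [isChain_iff_forall_rel_of_append_cons_cons] at hxy
  push Not at hxy
  obtain ⟨a, b, l₁, l₂, rfl, hab⟩ := hxy
  refine ⟨l₁, a, b, l₂, rfl, hab, ?_, ?_⟩
  · have h : (l₁ ++ [a]).IsChain (G ⊔ SimpleGraph.edge x y).Adj :=
      hc.infix ⟨[], b :: l₂, by simp⟩
    refine h.imp_of_mem_imp fun c d hc hd hcd => ?_
    have : s(c, d) ≠ s(a, b) := by
      intro h
      have hb : b ∈ l₁ ++ [a] := by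
        have : b ∈ s(c, d) := by simp [h]
        rcases Sym2.mem_iff.1 this with rfl | rfl <;> assumption
      simp_all [nodup_append]
      grind
    grind
  · have h : (b :: l₂).IsChain (G ⊔ SimpleGraph.edge x y).Adj :=
      hc.infix ⟨l₁ ++ [a], [], by simp⟩
    refine h.imp_of_mem_imp fun c d hc hd hcd => ?_
    have : s(c, d) ≠ s(a, b) := by
      intro h
      have hb : a ∈ b :: l₂ := by
        have : a ∈ s(c, d) := by simp [h]
        rcases Sym2.mem_iff.1 this with rfl | rfl <;> assumption
      simp_all [nodup_append]
    grind

end List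

namespace SimpleGraph

variable {V : Type*} {G : SimpleGraph V} {u v : V}

/-- The list `l` enumerates the vertices of a Hamilton path of `G` from `u` to `v`. -/
structure IsHamiltonList (G : SimpleGraph V) (u v : V) (l : List V) : Prop where
  nodup : l.Nodup
  mem : ∀ w, w ∈ l
  isChain : l.IsChain G.Adj
  head? : l.head? = some u
  getLast? : l.getLast? = some v

lemma IsHamiltonList.reverse {l : List V} (h : G.IsHamiltonList u v l) :
    G.IsHamiltonList v u l.reverse where
  nodup := by simpa using h.nodup
  mem := by simpa using h.mem
  isChain := (List.isChain_reverse_iff_of_symm fun _ _ h => h.symm).2 h.isChain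
  head? := by simpa using h.getLast?
  getLast? := by simpa using h.head?

lemma IsHamiltonList.exists_walk [DecidableEq V] {l : List V} (h : G.IsHamiltonList u v l) :
    ∃ p : G.Walk u v, p.IsHamiltonian := by
  have hne : l ≠ [] := by rintro rfl; simpa using h.head?
  have hu : l.head hne = u := by simpa [List.head?_eq_some_head hne] using h.head?
  have hv : l.getLast hne = v := by simpa [List.getLast?_eq_some_getLast hne] using h.getLast?
  subst hu hv
  refine ⟨Walk.ofSupport l hne h.isChain, Walk.IsPath.isHamiltonian_of_mem ?_ ?_⟩
  · rw [Walk.isPath_def, Walk.support_ofSupport]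
    exact h.nodup
  · simpa [Walk.support_ofSupport] using h.mem

/-- A Hamilton path of `G + xy` through the edge `xy` whose ends are adjacent in `G` yields
a Hamilton path of `G` from `x` to `y`. -/
lemma IsHamiltonList.exists_of_adj {x y : V} {l : List V}
    (h : (G ⊔ edge x y).IsHamiltonList u v l)
    (hxy : ¬ l.IsChain fun a b => s(a, b) ≠ s(x, y)) (huv : G.Adj u v) :
    ∃ l', G.IsHamiltonList x y l' := by
  obtain ⟨l₁, a, b, l₂, rfl, hab, h₁, h₂⟩ := List.isChain_split_of_nodup h.nodup h.isChain hxy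
  have hu : (l₁ ++ [a]).head? = some u := by
    have := h.head?
    cases l₁ <;> simpa using this
  have hv : (b :: l₂).getLast? = some v := by
    have := h.getLast?
    simpa using this
  have key : G.IsHamiltonList a b ((l₁ ++ [a]).reverse ++ (b :: l₂).reverse) := by
    have hperm : ((l₁ ++ [a]).reverse ++ (b :: l₂).reverse).Perm (l₁ ++ a :: b :: l₂) := by
      refine ((List.reverse_perm _).append (List.reverse_perm _)).trans ?_
      simp
    refine ⟨hperm.nodup_iff.2 h.nodup, fun w => hperm.mem_iff.2 (h.mem w), ?_, by simp,
      by rw [List.getLast?_append]; simp⟩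
    rw [List.isChain_append, List.isChain_reverse_iff_of_symm fun _ _ h => h.symm,
      List.isChain_reverse_iff_of_symm fun _ _ h => h.symm]
    refine ⟨h₁, h₂, ?_⟩
    rw [List.getLast?_reverse, List.head?_reverse, hu, hv]
    simpa using huv
  rcases Sym2.eq_iff.1 hab with ⟨rfl, rfl⟩ | ⟨rfl, rfl⟩
  · exact ⟨_, key⟩
  · exact ⟨_, key.reverse⟩

/-- A Hamilton path of `G + xy` from `u` to `v` through the edge `xy` yields a Hamilton path of
`G + uv` through the edge `uv` with ends `x` and `y`. -/
lemma IsHamiltonList.exists_swap {x y : V} {l : List V} (huv : u ≠ v)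
    (h : (G ⊔ edge x y).IsHamiltonList u v l)
    (hxy : ¬ l.IsChain fun a b => s(a, b) ≠ s(x, y)) :
    ∃ a b l', s(a, b) = s(x, y) ∧ (G ⊔ edge u v).IsHamiltonList a b l' ∧
      ¬ l'.IsChain fun a b => s(a, b) ≠ s(u, v) := by
  obtain ⟨l₁, a, b, l₂, rfl, hab, h₁, h₂⟩ := List.isChain_split_of_nodup h.nodup h.isChain hxy
  have hu : (l₁ ++ [a]).head? = some u := by
    have := h.head?
    cases l₁ <;> simpa using this
  have hv : (b :: l₂).getLast? = some v := by
    have := h.getLast?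
    simpa using this
  have hperm : ((b :: l₂) ++ (l₁ ++ [a])).Perm (l₁ ++ a :: b :: l₂) := by
    refine List.perm_append_comm.trans ?_
    simp
  refine ⟨b, a, (b :: l₂) ++ (l₁ ++ [a]), Sym2.eq_swap.trans hab,
    ⟨hperm.nodup_iff.2 h.nodup, fun w => hperm.mem_iff.2 (h.mem w), ?_, by simp,
      by rw [List.getLast?_append]; simp⟩, ?_⟩
  · rw [List.isChain_append, hu, hv]
    refine ⟨h₂.imp fun _ _ => Or.inl, h₁.imp fun _ _ => Or.inl, ?_⟩
    simp [edge_adj, huv.symm]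
  · rw [List.isChain_append, hu, hv]
    simp

section Rotation

variable {x y : V} {l : List V} {i j : ℕ} {c d c' d' : V}

lemma IsHamiltonList.exists_rotation_of_le (h : (G ⊔ edge x y).IsHamiltonList u v l)
    (hxy : ¬ l.IsChain fun a b => s(a, b) ≠ s(x, y)) (hij : i ≤ j)
    (hc' : l[i]? = some c') (hc : l[i + 1]? = some c) (hd : l[j + 1]? = some d)
    (hd' : l[j + 2]? = some d') (huc : G.Adj u c) (hvd : G.Adj v d)
    (hcc : s(c', c) ≠ s(x, y)) (hdd : s(d, d') ≠ s(x, y)) :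
    ∃ l', (G ⊔ edge x y).IsHamiltonList c' d' l' ∧
      ¬ l'.IsChain fun a b => s(a, b) ≠ s(x, y) := by
  obtain ⟨hj, -⟩ := List.getElem?_eq_some_iff.1 hd'
  have hl : l = l.take (i + 1) ++ (l.drop (i + 1)).take (j + 1 - i) ++ l.drop (j + 2) := by
    conv_lhs => rw [← List.take_append_drop (i + 1) l,
      ← List.take_append_drop (j + 1 - i) (l.drop (i + 1)), List.drop_drop,
      show i + 1 + (j + 1 - i) = j + 2 by omega]
    simp
  have hp₀ : (l.take (i + 1)).head? = some u := by simp [List.head?_take, h.head?]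
  have hp₁ : (l.take (i + 1)).getLast? = some c' := by simp [List.getLast?_take, hc']
  have hq₀ : ((l.drop (i + 1)).take (j + 1 - i)).head? = some c := by
    rw [List.head?_take, if_neg (by omega), List.head?_drop, hc]
  have hq₁ : ((l.drop (i + 1)).take (j + 1 - i)).getLast? = some d := by
    rw [List.getLast?_take, if_neg (by omega), List.getElem?_drop,
      show i + 1 + (j + 1 - i - 1) = j + 1 by omega, hd]
    rfl
  have ht₀ : (l.drop (j + 2)).head? = some d' := by rw [List.head?_drop, hd']
  have ht₁ : (l.drop (j + 2)).getLast? = some v := by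
    rw [List.getLast?_drop, if_neg (by omega), h.getLast?]
  generalize l.take (i + 1) = P at *
  generalize (l.drop (i + 1)).take (j + 1 - i) = Q at *
  generalize l.drop (j + 2) = T at *
  subst hl
  have hperm : (P.reverse ++ Q ++ T.reverse).Perm (P ++ Q ++ T) :=
    ((List.reverse_perm _).append_right _).append (List.reverse_perm _)
  have hchain {R : V → V → Prop} (hR : ∀ a b, R a b → R b a) :
      (P.reverse ++ Q ++ T.reverse).IsChain R ↔
        P.IsChain R ∧ Q.IsChain R ∧ T.IsChain R ∧ R u c ∧ R d v := by
    rw [List.isChain_append_append_iff (by simpa using hp₀) hq₀ hq₁ (by simpa using ht₁),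
      List.isChain_reverse_iff_of_symm hR, List.isChain_reverse_iff_of_symm hR]
  have hc := h.isChain
  rw [List.isChain_append_append_iff hp₁ hq₀ hq₁ ht₀] at hc hxy
  refine ⟨_, ⟨hperm.nodup_iff.2 h.nodup, fun w => hperm.mem_iff.2 (h.mem w), ?_, ?_, ?_⟩, ?_⟩
  · rw [hchain fun _ _ h => h.symm]
    exact ⟨hc.1, hc.2.1, hc.2.2.1, Or.inl huc, Or.inl hvd.symm⟩
  · simp [List.head?_append, hp₁]
  · simp [List.getLast?_append, ht₀]
  · rw [hchain fun _ _ h => by rwa [Sym2.eq_swap]]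
    tauto

lemma IsHamiltonList.exists_rotation_of_lt (h : (G ⊔ edge x y).IsHamiltonList u v l)
    (hxy : ¬ l.IsChain fun a b => s(a, b) ≠ s(x, y)) (hij : j < i)
    (hc' : l[i + 1]? = some c') (hc : l[i]? = some c) (hd : l[j]? = some d)
    (hd' : l[j + 1]? = some d') (huc : G.Adj u c) (hvd : G.Adj v d)
    (hcc : s(c, c') ≠ s(x, y)) (hdd : s(d, d') ≠ s(x, y)) :
    ∃ l', (G ⊔ edge x y).IsHamiltonList d' c' l' ∧
      ¬ l'.IsChain fun a b => s(a, b) ≠ s(x, y) := by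
  obtain ⟨hj, -⟩ := List.getElem?_eq_some_iff.1 hc'
  have hl : l = l.take (j + 1) ++ (l.drop (j + 1)).take (i - j) ++ l.drop (i + 1) := by
    conv_lhs => rw [← List.take_append_drop (j + 1) l,
      ← List.take_append_drop (i - j) (l.drop (j + 1)), List.drop_drop,
      show j + 1 + (i - j) = i + 1 by omega]
    simp
  have hp₀ : (l.take (j + 1)).head? = some u := by simp [List.head?_take, h.head?]
  have hp₁ : (l.take (j + 1)).getLast? = some d := by simp [List.getLast?_take, hd]
  have hq₀ : ((l.drop (j + 1)).take (i - j)).head? = some d' := by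
    rw [List.head?_take, if_neg (by omega), List.head?_drop, hd']
  have hq₁ : ((l.drop (j + 1)).take (i - j)).getLast? = some c := by
    rw [List.getLast?_take, if_neg (by omega), List.getElem?_drop,
      show j + 1 + (i - j - 1) = i by omega, hc]
    rfl
  have ht₀ : (l.drop (i + 1)).head? = some c' := by rw [List.head?_drop, hc']
  have ht₁ : (l.drop (i + 1)).getLast? = some v := by
    rw [List.getLast?_drop, if_neg (by omega), h.getLast?]
  generalize l.take (j + 1) = P at *
  generalize (l.drop (j + 1)).take (i - j) = Q at *
  generalize l.drop (i + 1) = T at *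
  subst hl
  have hperm : (Q ++ P ++ T.reverse).Perm (P ++ Q ++ T) :=
    List.perm_append_comm.append (List.reverse_perm _)
  have hchain {R : V → V → Prop} (hR : ∀ a b, R a b → R b a) :
      (Q ++ P ++ T.reverse).IsChain R ↔
        Q.IsChain R ∧ P.IsChain R ∧ T.IsChain R ∧ R c u ∧ R d v := by
    rw [List.isChain_append_append_iff hq₁ hp₀ hp₁ (by simpa using ht₁),
      List.isChain_reverse_iff_of_symm hR]
  have hc := h.isChain
  rw [List.isChain_append_append_iff hp₁ hq₀ hq₁ ht₀] at hc hxy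
  refine ⟨_, ⟨hperm.nodup_iff.2 h.nodup, fun w => hperm.mem_iff.2 (h.mem w), ?_, ?_, ?_⟩, ?_⟩
  · rw [hchain fun _ _ h => h.symm]
    exact ⟨hc.2.1, hc.1, hc.2.2.1, Or.inl huc.symm, Or.inl hvd.symm⟩
  · simp [List.head?_append, hq₀]
  · simp [List.getLast?_append, ht₀]
  · rw [hchain fun _ _ h => by rwa [Sym2.eq_swap]]
    tauto

end Rotation

lemma exists_isHamiltonList_top [Fintype V] [DecidableEq V] (huv : u ≠ v) :
    ∃ l, (⊤ : SimpleGraph V).IsHamiltonList u v l := by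
  have hnd : (u :: (((Finset.univ.erase u).erase v).toList ++ [v])).Nodup := by
    simp +contextual [List.nodup_append, Finset.nodup_toList, huv]
  refine ⟨_, hnd, fun w => ?_, ?_, rfl,
    by rw [← List.cons_append, List.getLast?_append]; simp⟩
  · simp
    tauto
  · exact (show List.Pairwise (⊤ : SimpleGraph V).Adj _ from hnd.imp fun h => h).isChain

lemma exists_adj_of_not_hasBipartiteHole_s5 {s t : ℕ} (hst : ¬ G.HasBipartiteHole s t)
    {f g : ℕ → V} {A B : Finset ℕ} (hA : A.card = s) (hB : B.card = t)
    (hf : Set.InjOn f A) (hg : Set.InjOn g B) (hfg : ∀ i ∈ A, ∀ j ∈ B, f i ≠ g j) :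
    ∃ i ∈ A, ∃ j ∈ B, G.Adj (f i) (g j) := by
  classical
  by_contra! h
  refine hst ⟨A.image f, B.image g, ?_, ?_, ?_, ?_⟩
  · rw [Finset.disjoint_left]
    simp only [Finset.mem_image, not_exists, not_and]
    rintro _ ⟨i, hi, rfl⟩ j hj
    exact (hfg i hi j hj).symm
  · rw [Finset.card_image_of_injOn hf, hA]
  · rw [Finset.card_image_of_injOn hg, hB]
  · simpa using h

lemma HasBipartiteHole.symm {s t : ℕ} (h : G.HasBipartiteHole s t) : G.HasBipartiteHole t s := by
  obtain ⟨S, T, hd, hS, hT, hST⟩ := h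
  exact ⟨T, S, hd.symm, hT, hS, fun a ha b hb hab => hST b hb a ha hab.symm⟩

variable [Fintype V]

/-- If every degree is at least `s + t` and `G` has no `(s, t)`-bipartite-hole, then a Hamilton
path of `G + xy` through `xy` yields a Hamilton path of `G` from `x` to `y`. -/
lemma IsHamiltonList.exists_of_not_hasBipartiteHole [DecidableEq V] [DecidableRel G.Adj]
    {x y : V} {l : List V} {s t : ℕ} (hs : 0 < s) (ht : 0 < t)
    (hst : ¬ G.HasBipartiteHole s t) (hdeg : ∀ w, s + t ≤ G.degree w)
    (h : (G ⊔ edge x y).IsHamiltonList u v l)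
    (hxy : ¬ l.IsChain fun a b => s(a, b) ≠ s(x, y)) :
    ∃ l', G.IsHamiltonList x y l' := by
  by_cases huv : G.Adj u v
  · exact h.exists_of_adj hxy huv
  have hl : 0 < l.length := List.length_pos_of_mem (h.mem u)
  obtain ⟨f, hf⟩ : ∃ f : ℕ → V, ∀ i < l.length, l[i]? = some (f i) :=
    ⟨fun i => l.getD i u, fun i hi => by simp [hi]⟩
  have hinj : ∀ i < l.length, ∀ j < l.length, f i = f j → i = j := by
    intro i hi j hj hij
    exact (List.getElem?_inj hi h.nodup).1 ((hf i hi).trans (hij ▸ (hf j hj).symm))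
  have hsurj : ∀ w, ∃ i < l.length, f i = w := by
    intro w
    obtain ⟨i, hi, rfl⟩ := List.mem_iff_getElem.1 (h.mem w)
    exact ⟨i, hi, by simpa [hi] using (hf i hi).symm⟩
  have hf0 : f 0 = u := by
    have := hf 0 hl
    rw [← List.head?_eq_getElem?, h.head?] at this
    simpa using this.symm
  have hfl : f (l.length - 1) = v := by
    have := hf (l.length - 1) (by omega)
    rw [← List.getLast?_eq_getElem?, h.getLast?] at this
    simpa using this.symm
  obtain ⟨m, hm⟩ : ∃ m, ∀ c, c + 1 < l.length → s(f c, f (c + 1)) = s(x, y) → c = m := by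
    by_cases hex : ∃ m, m + 1 < l.length ∧ s(f m, f (m + 1)) = s(x, y)
    · obtain ⟨m, hm, hmxy⟩ := hex
      refine ⟨m, fun c hc hcxy => ?_⟩
      rcases Sym2.eq_iff.1 (hcxy.trans hmxy.symm) with ⟨h1, -⟩ | ⟨h1, h2⟩
      · exact hinj _ (by omega) _ (by omega) h1
      · have := hinj _ (by omega) _ (by omega) h1
        have := hinj _ (by omega) _ (by omega) h2
        omega
    · push Not at hex
      exact ⟨0, fun c hc hcxy => absurd hcxy (hex c hc)⟩
  have hcard (w : V) : s + t ≤ ((Finset.range l.length).filter fun i => G.Adj w (f i)).card := by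
    refine (hdeg w).trans ?_
    rw [← G.card_neighborFinset_eq_degree]
    refine (Finset.card_le_card fun z hz => ?_).trans (Finset.card_image_le (f := f))
    obtain ⟨i, hi, rfl⟩ := hsurj z
    rw [mem_neighborFinset] at hz
    exact Finset.mem_image_of_mem f (by simp [hi, hz])
  have hAmem {i : ℕ} (hi : i ∈ (Finset.range l.length).filter fun i => G.Adj u (f i)) :
      0 < i ∧ i + 1 < l.length ∧ G.Adj u (f i) := by
    simp only [Finset.mem_filter, Finset.mem_range] at hi
    refine ⟨Nat.pos_of_ne_zero ?_, Nat.lt_of_le_of_ne hi.1 ?_, hi.2⟩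
    · rintro rfl
      exact G.irrefl (hf0 ▸ hi.2)
    · intro hil
      apply huv
      rw [← hfl, ← hil]
      exact hi.2
  have hBmem {i : ℕ} (hi : i ∈ (Finset.range l.length).filter fun i => G.Adj v (f i)) :
      0 < i ∧ i + 1 < l.length ∧ G.Adj v (f i) := by
    simp only [Finset.mem_filter, Finset.mem_range] at hi
    refine ⟨Nat.pos_of_ne_zero ?_, Nat.lt_of_le_of_ne hi.1 ?_, hi.2⟩
    · rintro rfl
      exact huv (hf0 ▸ hi.2.symm)
    · intro hil
      apply G.irrefl (v := v)
      nth_rw 2 [← hfl]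
      rw [← hil]
      exact hi.2
  rcases exists_noncrossing_or_crossing_subsets (m := m) hs ht (hcard u) (hcard v) with
    ⟨A, hA, B, hB, hAs, hBt, hmA, hmB, hAB⟩ | ⟨A, hA, B, hB, hAt, hBs, hmA, hmB, hAB⟩
  · obtain ⟨i, hi, j, hj, hij⟩ := exists_adj_of_not_hasBipartiteHole_s5 hst
      (f := fun i => f (i - 1)) (g := fun j => f (j + 1)) hAs hBt
      (fun a ha b hb hab => by
        have ha := hAmem (hA ha)
        have hb := hAmem (hA hb)
        have := hinj _ (by omega) _ (by omega) hab
        omega)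
      (fun a ha b hb hab => by
        have ha := hBmem (hB ha)
        have hb := hBmem (hB hb)
        have := hinj _ (by omega) _ (by omega) hab
        omega)
      (fun a ha b hb hab => by
        have hle := hAB a ha b hb
        have ha := hAmem (hA ha)
        have hb := hBmem (hB hb)
        have := hinj _ (by omega) _ (by omega) hab
        omega)
    have hle := hAB i hi j hj
    obtain ⟨hi0, hil, hui⟩ := hAmem (hA hi)
    obtain ⟨hj0, hjl, hvj⟩ := hBmem (hB hj)
    obtain ⟨i, rfl⟩ := Nat.exists_eq_add_of_lt hi0
    obtain ⟨j, rfl⟩ := Nat.exists_eq_add_of_lt hj0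
    simp only [zero_add, add_tsub_cancel_right] at *
    obtain ⟨l', hl', hl'xy⟩ := h.exists_rotation_of_le hxy (i := i) (j := j) (by omega)
      (hf _ (by omega)) (hf _ (by omega)) (hf _ (by omega)) (hf _ (by omega)) hui hvj
      (fun he => hmA (hm _ (by omega) he ▸ hi)) (fun he => hmB (hm _ (by omega) he ▸ hj))
    exact hl'.exists_of_adj hl'xy hij
  · obtain ⟨i, hi, j, hj, hij⟩ := exists_adj_of_not_hasBipartiteHole_s5 (fun h => hst h.symm)
      (f := fun i => f (i + 1)) (g := fun j => f (j + 1)) hAt hBs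
      (fun a ha b hb hab => by
        have ha := hAmem (hA ha)
        have hb := hAmem (hA hb)
        have := hinj _ (by omega) _ (by omega) hab
        omega)
      (fun a ha b hb hab => by
        have ha := hBmem (hB ha)
        have hb := hBmem (hB hb)
        have := hinj _ (by omega) _ (by omega) hab
        omega)
      (fun a ha b hb hab => by
        have hlt := hAB a ha b hb
        have ha := hAmem (hA ha)
        have hb := hBmem (hB hb)
        have := hinj _ (by omega) _ (by omega) hab
        omega)
    obtain ⟨hi0, hil, hui⟩ := hAmem (hA hi)
    obtain ⟨hj0, hjl, hvj⟩ := hBmem (hB hj)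
    obtain ⟨l', hl', hl'xy⟩ := h.exists_rotation_of_lt hxy (hAB i hi j hj)
      (hf _ (by omega)) (hf _ (by omega)) (hf _ (by omega)) (hf _ (by omega)) hui hvj
      (fun he => hmA (hm _ (by omega) he ▸ hi)) (fun he => hmB (hm _ (by omega) he ▸ hj))
    exact hl'.exists_of_adj hl'xy hij.symm

lemma exists_isHamiltonList_of_not_hasBipartiteHole [DecidableEq V] [DecidableRel G.Adj]
    {s t : ℕ} (hs : 0 < s) (ht : 0 < t) (hst : ¬ G.HasBipartiteHole s t)
    (hdeg : ∀ w, s + t ≤ G.degree w) (huv : u ≠ v) : ∃ l, G.IsHamiltonList u v l := by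
  classical
  by_contra hG
  obtain ⟨M, hGM, hM⟩ := Finite.exists_le_maximal
    (p := fun M : SimpleGraph V => ¬ ∃ l, M.IsHamiltonList u v l) hG
  have hne : M ≠ ⊤ := by
    rintro rfl
    exact hM.1 (exists_isHamiltonList_top huv)
  obtain ⟨x, y, hxy, hadj⟩ : ∃ x y, x ≠ y ∧ ¬ M.Adj x y := by
    by_contra! hall
    exact hne (top_le_iff.1 fun a b hab => hall a b hab)
  obtain ⟨l, hl⟩ : ∃ l, (M ⊔ edge x y).IsHamiltonList u v l := by
    by_contra hcon
    exact hadj (hM.2 hcon le_sup_left (Or.inr (by simp [edge_adj, hxy])))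
  have hlxy : ¬ l.IsChain fun a b => s(a, b) ≠ s(x, y) := by
    intro hc
    refine hM.1 ⟨l, hl.nodup, hl.mem, ?_, hl.head?, hl.getLast?⟩
    rw [List.isChain_iff_forall_rel_of_append_cons_cons]
    intro a b l₁ l₂ h
    have h₁ := List.isChain_iff_forall_rel_of_append_cons_cons.1 hl.isChain h
    have h₂ := List.isChain_iff_forall_rel_of_append_cons_cons.1 hc h
    grind
  obtain ⟨a, b, l', -, hl', hl'uv⟩ := hl.exists_swap huv hlxy
  refine hM.1 (hl'.exists_of_not_hasBipartiteHole hs ht ?_ (fun w => (hdeg w).trans ?_) hl'uv)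
  · rintro ⟨S, T, hd, hS, hT, hST⟩
    exact hst ⟨S, T, hd, hS, hT, fun a ha b hb hab => hST a ha b hb (hGM hab)⟩
  · exact degree_le_of_le hGM

lemma bipartiteHoleNumber_spec (G : SimpleGraph V) : ∃ s t : ℕ, 0 < s ∧ 0 < t ∧
    s + t = G.bipartiteHoleNumber + 1 ∧ ¬ G.HasBipartiteHole s t := by
  refine Nat.sInf_mem (s := {k : ℕ | ∃ s t : ℕ, 0 < s ∧ 0 < t ∧ s + t = k + 1 ∧
    ¬ G.HasBipartiteHole s t}) ⟨Fintype.card V + 1, Fintype.card V + 1, 1, by omega, by omega, rfl,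
    ?_⟩
  rintro ⟨S, T, -, hS, -⟩
  have := S.card_le_univ
  omega

end SimpleGraph

theorem hamiltonianConnected_of_minDegree_ge_bipartiteHoleNumber_add_one
    {V : Type*} [Fintype V] [DecidableEq V]
    (G : SimpleGraph V) [DecidableRel G.Adj] (hn : 3 ≤ Fintype.card V)
    (hδ : G.bipartiteHoleNumber + 1 ≤ G.minDegree) :
    ∀ u v : V, u ≠ v → ∃ p : G.Walk u v, p.IsHamiltonian := by
  intro u v huv
  obtain ⟨s, t, hs, ht, hk, hst⟩ := G.bipartiteHoleNumber_spec
  obtain ⟨l, hl⟩ := SimpleGraph.exists_isHamiltonList_of_not_hasBipartiteHole hs ht hst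
    (fun w => hk ▸ hδ.trans (G.minDegree_le_degree w)) huv
  exact hl.exists_walk
end

section
/- Let G be a 2-connected finite simple graph of order n. Then G contains a cycle passing through every vertex of G whose degree is at least n/2. -/
namespace SimpleGraph

variable {V : Type*} {G : SimpleGraph V} {u v : V}

namespace Walk

lemma exists_eq_append_cons_of_lt_length (p : G.Walk u v) {i : ℕ} (hi : i < p.length) :
    ∃ (h : G.Adj (p.getVert i) (p.getVert (i + 1))) (q : G.Walk u (p.getVert i))
      (r : G.Walk (p.getVert (i + 1)) v), p = q.append (cons h r) := by
  induction p generalizing i with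
  | nil => simp at hi
  | cons h p ih =>
    cases i with
    | zero => exact ⟨by simpa using h, .nil, p.copy (by simp) rfl, by cases p <;> rfl⟩
    | succ i =>
      obtain ⟨h', q, r, hp⟩ := ih (i := i) (by simpa using hi)
      exact ⟨h', cons h q, r, congrArg (cons h) hp⟩

/-- A cycle through an edge `uv` yields a path from `u` to `v` avoiding that edge. -/
lemma IsCycle.exists_isPath_of_mem_edges {a : V} {c : G.Walk a a} (hc : c.IsCycle)
    (he : s(u, v) ∈ c.edges) :
    ∃ p : G.Walk u v, p.IsPath ∧ s(u, v) ∉ p.edges ∧ ∀ w ∈ c.support, w ∈ p.support := by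
  classical
  have hu : u ∈ c.support := c.fst_mem_support_of_mem_edges he
  suffices H : ∀ c' : G.Walk u u, c'.IsCycle → c'.snd = v →
      ∃ p : G.Walk u v, p.IsPath ∧ s(u, v) ∉ p.edges ∧ ∀ w ∈ c'.support, w ∈ p.support by
    have hr : (c.rotate u hu).IsCycle := by simpa using hc
    have hmem : ∀ w ∈ c.support, w ∈ (c.rotate u hu).support := by simp
    have he' : s(u, v) ∈ (c.rotate u hu).edges := (c.rotate_edges u hu).mem_iff.2 he
    generalize c.rotate u hu = c' at hr hmem he'
    by_cases hv : c'.snd = v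
    · obtain ⟨p, hp, hpe, hps⟩ := H c' hr hv
      exact ⟨p, hp, hpe, fun w hw => hps w (hmem w hw)⟩
    · have hv' : c'.reverse.snd = v := by
        rw [snd_reverse]
        cases c' with
        | nil => simp at hr
        | cons h q =>
          have hq := (cons_isCycle_iff _ _).1 hr
          rw [penultimate_cons_of_not_nil _ _ (not_nil_of_isCycle_cons hr)]
          refine (hq.1.eq_penultimate_of_mem_edges ?_).symm
          simp only [edges_cons, List.mem_cons] at he'
          refine he'.resolve_left fun h => hv ?_
          simp at h hv
          grind
      obtain ⟨p, hp, hpe, hps⟩ := H c'.reverse hr.reverse hv'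
      exact ⟨p, hp, hpe, fun w hw => hps w (by simpa using hmem w hw)⟩
  intro c' hc' hv
  cases c' with
  | nil => simp at hc'
  | cons h q =>
    obtain rfl : _ = v := by simpa using hv
    have hq := (cons_isCycle_iff _ _).1 hc'
    exact ⟨q.reverse, by simpa using hq.1, by simpa using hq.2, by simp⟩

lemma IsPath.exists_isCycle_of_common_adj {p : G.Walk u v} (hp : p.IsPath) (huv : u ≠ v) {w : V}
    (hw : w ∉ p.support) (hu : G.Adj u w) (hv : G.Adj v w) :
    ∃ c : G.Walk w w, c.IsCycle ∧ ∀ x ∈ p.support, x ∈ c.support := by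
  refine ⟨cons hu.symm (p.concat hv), (cons_isCycle_iff _ _).2 ⟨hp.concat hw hv, ?_⟩, ?_⟩
  · intro h
    rw [edges_concat, List.concat_eq_append, List.mem_append] at h
    rcases h with h | h
    · exact hw (p.fst_mem_support_of_mem_edges h)
    · simp at h
      grind
  · intro x hx
    simp [support_concat, hx]

lemma IsPath.exists_isCycle_of_crossing {p : G.Walk u v} (hp : p.IsPath) (huv : ¬ G.Adj u v)
    {i : ℕ} (hi : i < p.length) (hv : G.Adj v (p.getVert i)) (hu : G.Adj u (p.getVert (i + 1))) :
    ∃ c : G.Walk u u, c.IsCycle ∧ ∀ x ∈ p.support, x ∈ c.support := by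
  obtain ⟨h, q, r, hqr⟩ := p.exists_eq_append_cons_of_lt_length hi
  generalize p.getVert i = x at *
  generalize p.getVert (i + 1) = y at *
  subst hqr
  have hnd := hp.support_nodup
  simp only [support_append, support_cons, List.tail_cons] at hnd
  have hdis := (List.nodup_append'.1 hnd).2.2
  refine ⟨cons hu (r.append (cons hv q.reverse)), (cons_isCycle_iff _ _).2 ⟨?_, ?_⟩, ?_⟩
  · rw [isPath_def]
    simp only [support_append, support_cons, List.tail_cons, support_reverse]
    have := List.nodup_append'.1 hnd
    exact List.nodup_append'.2 ⟨this.2.1, List.nodup_reverse.2 this.1,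
      fun a ha hb => hdis (List.mem_reverse.1 hb) ha⟩
  · intro he
    simp only [edges_append, edges_cons, edges_reverse, List.mem_append, List.mem_cons,
      List.mem_reverse] at he
    rcases he with he | he | he
    · exact hdis q.start_mem_support (r.fst_mem_support_of_mem_edges he)
    · rw [Sym2.eq_iff] at he
      rcases he with ⟨rfl, rfl⟩ | ⟨rfl, rfl⟩
      · exact hdis q.start_mem_support r.end_mem_support
      · exact huv h
    · exact hdis (q.snd_mem_support_of_mem_edges he) r.start_mem_support
  · intro a ha
    simp only [mem_support_append_iff, support_cons, List.mem_cons, support_reverse,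
      List.mem_reverse] at ha ⊢
    have := q.end_mem_support
    grind

/-- Ore's crossing argument: a path joining two nonadjacent vertices of large degree sum is
contained in a cycle, up to reordering. -/
lemma IsPath.exists_isCycle_of_card_le_degree_add_degree [Fintype V] [DecidableRel G.Adj]
    {p : G.Walk u v} (hp : p.IsPath) (hne : u ≠ v) (huv : ¬ G.Adj u v)
    (hdeg : Fintype.card V ≤ G.degree u + G.degree v) :
    ∃ (a : V) (c : G.Walk a a), c.IsCycle ∧ ∀ x ∈ p.support, x ∈ c.support := by
  classical
  by_cases hcommon : ∃ w ∉ p.support, G.Adj u w ∧ G.Adj v w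
  · obtain ⟨w, hw, hu, hv⟩ := hcommon
    exact ⟨w, hp.exists_isCycle_of_common_adj hne hw hu hv⟩
  by_cases hcross : ∃ i < p.length, G.Adj v (p.getVert i) ∧ G.Adj u (p.getVert (i + 1))
  · obtain ⟨i, hi, hv, hu⟩ := hcross
    exact ⟨u, hp.exists_isCycle_of_crossing huv hi hv hu⟩
  exfalso
  push Not at hcommon hcross
  have hindex : ∀ w, G.Adj u w → w ∈ p.support → ∃ i < p.length, p.getVert (i + 1) = w := by
    intro w hw hwp
    obtain ⟨j, rfl, hj⟩ := mem_support_iff_exists_getVert.1 hwp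
    cases j with
    | zero => simp at hw
    | succ i => exact ⟨i, hj, rfl⟩
  choose! i hi hiw using hindex
  -- Vertices of the path are moved to their predecessor, the others are fixed.
  let f : V → V := fun w => if w ∈ p.support then p.getVert (i w) else w
  have hinj : Set.InjOn f (G.neighborFinset u) := by
    intro a ha b hb hab
    simp only [Finset.mem_coe, mem_neighborFinset] at ha hb
    by_cases hap : a ∈ p.support <;> by_cases hbp : b ∈ p.support <;>
      simp only [f, hap, hbp, if_true, if_false] at hab
    · rw [← hiw a ha hap, ← hiw b hb hbp,
        hp.getVert_injOn (hi a ha hap).le (hi b hb hbp).le hab]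
    · exact absurd (hab ▸ p.getVert_mem_support _) hbp
    · exact absurd (hab ▸ p.getVert_mem_support _) hap
    · exact hab
  have hdis : Disjoint ((G.neighborFinset u).image f) (insert v (G.neighborFinset v)) := by
    rw [Finset.disjoint_left]
    intro b hb hbv
    obtain ⟨a, ha, rfl⟩ := Finset.mem_image.1 hb
    rw [mem_neighborFinset] at ha
    rw [Finset.mem_insert, mem_neighborFinset] at hbv
    by_cases hap : a ∈ p.support <;> simp only [f, hap, if_true, if_false] at hbv
    · rcases hbv with hbv | hbv
      · exact (hi a ha hap).ne ((hp.getVert_eq_end_iff (hi a ha hap).le).1 hbv)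
      · exact hcross _ (hi a ha hap) hbv ((hiw a ha hap).symm ▸ ha)
    · rcases hbv with rfl | hbv
      · exact huv ha
      · exact hcommon a hap ha hbv
  have hcard := Finset.card_le_univ ((G.neighborFinset u).image f ∪ insert v (G.neighborFinset v))
  rw [Finset.card_union_of_disjoint hdis, Finset.card_image_of_injOn hinj,
    Finset.card_insert_of_notMem (by simp), card_neighborFinset_eq_degree,
    card_neighborFinset_eq_degree] at hcard
  omega

end Walk

lemma IsClique.exists_isPath_support_toFinset_eq [DecidableEq V] {S : Finset V}
    (hS : G.IsClique S) (hu : u ∈ S) :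
    ∃ (b : V) (p : G.Walk u b), p.IsPath ∧ p.support.toFinset = S := by
  induction hn : S.card generalizing S u with
  | zero => simp_all
  | succ n ih =>
    by_cases hne : (S.erase u).Nonempty
    · obtain ⟨w, hw⟩ := hne
      obtain ⟨b, p, hp, hps⟩ := ih (hS.subset (by simp)) hw (by simp [hu, hn])
      have hwS := Finset.mem_erase.1 hw
      refine ⟨b, .cons (hS hu hwS.2 hwS.1.symm) p, hp.cons fun h => ?_, ?_⟩
      · simpa [hps] using List.mem_toFinset.2 h
      · rw [Walk.support_cons, List.toFinset_cons, hps, Finset.insert_erase hu]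
    · refine ⟨u, .nil, .nil, ?_⟩
      have := Finset.not_nonempty_iff_eq_empty.1 hne
      rw [← Finset.insert_erase hu, this]
      simp

lemma IsClique.exists_isCycle {S : Finset V} (hS : G.IsClique S) (hcard : 3 ≤ S.card) :
    ∃ (a : V) (c : G.Walk a a), c.IsCycle ∧ ∀ x ∈ S, x ∈ c.support := by
  classical
  obtain ⟨u, hu⟩ := Finset.card_pos.1 (by omega : 0 < S.card)
  obtain ⟨b, p, hp, hps⟩ := hS.exists_isPath_support_toFinset_eq hu
  have hlen : 2 ≤ p.length := by
    have := List.toFinset_card_le p.support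
    rw [hps, Walk.length_support] at this
    omega
  have hmem : ∀ x, x ∈ p.support ↔ x ∈ S := by simp [← hps]
  have hne : b ≠ u := by
    rintro rfl
    have := Walk.length_eq_zero_iff.2 (Walk.isPath_iff_nil.1 hp)
    omega
  refine ⟨b, .cons (hS ((hmem b).1 p.end_mem_support) hu hne) p,
    (Walk.cons_isCycle_iff _ _).2 ⟨hp, fun he => ?_⟩, fun x hx => ?_⟩
  · have := hp.length_eq_one_of_mem_edges (Sym2.eq_swap ▸ he)
    omega
  · simp [(hmem x).2 hx]

/-- A set of at least three vertices, any two of which have degree sum at least the order of the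
graph, lies on a cycle. -/
theorem exists_isCycle_of_pairwise_card_le_degree_add_degree [Fintype V] [DecidableRel G.Adj]
    {S : Finset V} (hcard : 3 ≤ S.card)
    (hdeg : ∀ u ∈ S, ∀ v ∈ S, u ≠ v → Fintype.card V ≤ G.degree u + G.degree v) :
    ∃ (a : V) (c : G.Walk a a), c.IsCycle ∧ ∀ x ∈ S, x ∈ c.support := by
  classical
  suffices H : ∀ K : SimpleGraph V, G ≤ K →
      ∃ (a : V) (c : K.Walk a a), c.IsCycle ∧ ∀ x ∈ S, x ∈ c.support from H G le_rfl
  intro K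
  induction K using WellFoundedGT.induction with
  | ind K ih =>
    intro hGK
    by_cases hK : K.IsClique S
    · exact hK.exists_isCycle hcard
    obtain ⟨u, hu, v, hv, hne, huv⟩ : ∃ u ∈ S, ∃ v ∈ S, u ≠ v ∧ ¬ K.Adj u v := by
      simpa [IsClique, Set.Pairwise] using hK
    obtain ⟨a, c, hc, hcS⟩ := ih (K ⊔ edge u v) (K.lt_sup_edge _ _ hne huv) (hGK.trans le_sup_left)
    have hedge : ∀ e ∈ (K ⊔ edge u v).edgeSet, e ≠ s(u, v) → e ∈ K.edgeSet := by
      intro e he hne'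
      rw [edgeSet_sup, edgeSet_edge_of_ne hne] at he
      exact he.resolve_right hne'
    by_cases he : s(u, v) ∈ c.edges
    · obtain ⟨p, hp, hpe, hps⟩ := hc.exists_isPath_of_mem_edges he
      have hpK : ∀ e ∈ p.edges, e ∈ K.edgeSet := fun e hep =>
        hedge e (p.edges_subset_edgeSet hep) (by rintro rfl; exact hpe hep)
      obtain ⟨b, d, hd, hds⟩ := (hp.transfer hpK).exists_isCycle_of_card_le_degree_add_degree hne huv
        ((hdeg u hu v hv hne).trans
          (Nat.add_le_add (degree_le_of_le hGK) (degree_le_of_le hGK)))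
      exact ⟨b, d, hd, fun x hx => hds x (by simpa using hps x (hcS x hx))⟩
    · have hcK : ∀ e ∈ c.edges, e ∈ K.edgeSet := fun e hec =>
        hedge e (c.edges_subset_edgeSet hec) (by rintro rfl; exact he hec)
      exact ⟨a, c.transfer K hcK, hc.transfer hcK, by simpa using hcS⟩

namespace TwoConnected

variable [Fintype V]

lemma exists_isPath_notMem_support (hG : G.TwoConnected) {w : V} (hu : u ≠ w) (hv : v ≠ w) :
    ∃ p : G.Walk u v, p.IsPath ∧ w ∉ p.support := by
  classical
  have hmap : ∀ {a b} (p : (G.induce {x | x ≠ w}).Walk a b),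
      w ∉ (p.map (Embedding.induce _).toHom).support := by
    intro a b p h
    rw [Walk.support_map, List.mem_map] at h
    obtain ⟨x, -, hx⟩ := h
    exact x.2 hx
  obtain ⟨p⟩ := (hG.2 w).preconnected ⟨u, hu⟩ ⟨v, hv⟩
  refine ⟨(p.map (Embedding.induce _).toHom).bypass, Walk.bypass_isPath _, fun h =>
    hmap p (Walk.support_bypass_subset_support _ h)⟩

lemma exists_ne_ne_s10 (hG : G.TwoConnected) (u v : V) : ∃ w, w ≠ u ∧ w ≠ v := by
  classical
  obtain ⟨w, -, hw⟩ := Finset.exists_mem_notMem_of_card_lt_card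
    (s := {u, v}) (t := Finset.univ) (Finset.card_le_two.trans_lt hG.1)
  exact ⟨w, by simpa using hw⟩

lemma exists_isPath (hG : G.TwoConnected) (u v : V) : ∃ p : G.Walk u v, p.IsPath := by
  obtain ⟨w, hu, hv⟩ := hG.exists_ne_ne_s10 u v
  obtain ⟨p, hp, -⟩ := hG.exists_isPath_notMem_support hu.symm hv.symm
  exact ⟨p, hp⟩

lemma exists_adj_ne_s10 (hG : G.TwoConnected) (huv : u ≠ v) : ∃ w, G.Adj u w ∧ w ≠ v := by
  obtain ⟨x, hxu, hxv⟩ := hG.exists_ne_ne_s10 u v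
  obtain ⟨p, -, hv⟩ := hG.exists_isPath_notMem_support huv hxv
  cases p with
  | nil => exact absurd rfl hxu
  | cons h q => exact ⟨_, h, fun hw => hv (by simp [← hw])⟩

lemma exists_isCycle_of_adj (hG : G.TwoConnected) (huv : G.Adj u v) :
    ∃ c : G.Walk v v, c.IsCycle ∧ u ∈ c.support ∧ v ∈ c.support := by
  obtain ⟨w, huw, hwv⟩ := hG.exists_adj_ne_s10 huv.ne
  obtain ⟨p, hp, hu⟩ := hG.exists_isPath_notMem_support huw.ne' huv.ne'
  refine ⟨.cons huv.symm (.cons huw p), (Walk.cons_isCycle_iff _ _).2 ⟨hp.cons hu, ?_⟩, by simp,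
    by simp⟩
  intro he
  rw [Walk.edges_cons, List.mem_cons] at he
  rcases he with he | he
  · have := huv.ne
    grind [Sym2.eq_iff]
  · exact hu (p.snd_mem_support_of_mem_edges he)

lemma exists_isCycle_of_card_le_degree_add_degree [DecidableRel G.Adj] (hG : G.TwoConnected)
    (hne : u ≠ v) (hdeg : Fintype.card V ≤ G.degree u + G.degree v) :
    ∃ (a : V) (c : G.Walk a a), c.IsCycle ∧ u ∈ c.support ∧ v ∈ c.support := by
  by_cases huv : G.Adj u v
  · exact ⟨v, hG.exists_isCycle_of_adj huv⟩
  · obtain ⟨p, hp⟩ := hG.exists_isPath u v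
    obtain ⟨a, c, hc, hcp⟩ := hp.exists_isCycle_of_card_le_degree_add_degree hne huv hdeg
    exact ⟨a, c, hc, hcp u p.start_mem_support, hcp v p.end_mem_support⟩

end TwoConnected

end SimpleGraph

theorem cycle_through_vertices_of_degree_ge_half {V : Type*} [Fintype V] [DecidableEq V]
    (G : SimpleGraph V) [DecidableRel G.Adj] (hG : G.TwoConnected) :
    ∃ (a : V) (c : G.Walk a a), c.IsCycle ∧
      ∀ v : V, Fintype.card V ≤ 2 * G.degree v → v ∈ c.support := by
  have : Nonempty V := Fintype.card_pos_iff.1 (by have := hG.1; omega)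
  let S : Finset V := {v | Fintype.card V ≤ 2 * G.degree v}
  suffices H : ∃ (a : V) (c : G.Walk a a), c.IsCycle ∧ ∀ v ∈ S, v ∈ c.support by
    simpa [S] using H
  have hdeg : ∀ u ∈ S, ∀ v ∈ S, Fintype.card V ≤ G.degree u + G.degree v := by
    intro u hu v hv
    simp only [S, Finset.mem_filter_univ] at hu hv
    omega
  rcases lt_or_ge 2 S.card with hS | hS
  · exact SimpleGraph.exists_isCycle_of_pairwise_card_le_degree_add_degree hS
      fun u hu v hv _ => hdeg u hu v hv
  rcases hS.lt_or_eq with hS | hS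
  · obtain ⟨u, hu⟩ := Finset.card_le_one_iff_subset_singleton.1 (Nat.le_of_lt_succ hS)
    obtain ⟨x, hx, -⟩ := hG.exists_ne_ne_s10 u u
    obtain ⟨v, huv, -⟩ := hG.exists_adj_ne_s10 hx.symm
    obtain ⟨c, hc, huc, -⟩ := hG.exists_isCycle_of_adj huv
    exact ⟨v, c, hc, fun w hw => by rwa [Finset.mem_singleton.1 (hu hw)]⟩
  · obtain ⟨u, v, hne, huv⟩ := Finset.card_eq_two.1 hS
    obtain ⟨a, c, hc, huc, hvc⟩ := hG.exists_isCycle_of_card_le_degree_add_degree hne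
      (hdeg u (by simp [huv]) v (by simp [huv]))
    exact ⟨a, c, hc, by simp [huv, huc, hvc]⟩
end
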